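/- arXiv:2209.01656 — 11 statements merged into one kernel-verified Lean document; each statement's English description precedes it below -/
import Mathlib

section
/- Let t and k be positive integers. There exists n0 = n0(t,k) such that for every integer n ≥ n0 with t ≤ n and n+t even, every t-intersecting k-Sperner family F ⊆ 2^[n] satisfies |F| ≤ Σ_{i=0}^{k-1} C(n, (n+t)/2 + i). -/
open Finset

/-- `F` is `t`-intersecting: every two members intersect in at least `t` elements. -/
def TIntersecting {n : ℕ} (t : ℕ) (F : Finset (Finset (Fin n))) : Prop :=
  ∀ A ∈ F, ∀ B ∈ F, t ≤ (A ∩ B).card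

/-- `F` is `k`-Sperner: it contains no chain of `k+1` sets `A_0 ⊊ A_1 ⊊ … ⊊ A_k`. -/
def IsKSperner {n : ℕ} (k : ℕ) (F : Finset (Finset (Fin n))) : Prop :=
  ¬ ∃ c : Fin (k + 1) → Finset (Fin n),
      (∀ i, c i ∈ F) ∧ ∀ i j : Fin (k + 1), i < j → c i ⊂ c j

/-- The binomial coefficients `n.choose j` are concave in `j` near the middle layer. -/
lemma choose_add_choose_le_two_mul_choose {n j : ℕ} (hj : j + 2 ≤ n)
    (h : (2 * (j + 1 : ℤ) - n) ^ 2 ≤ n + 2) :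
    n.choose j + n.choose (j + 2) ≤ 2 * n.choose (j + 1) := by
  obtain ⟨y, rfl⟩ := Nat.exists_eq_add_of_le hj
  have h₁ := Nat.choose_succ_right_eq (j + 2 + y) j
  have h₂ := Nat.choose_succ_right_eq (j + 2 + y) (j + 1)
  rw [show j + 2 + y - j = y + 2 by omega] at h₁
  rw [show j + 2 + y - (j + 1) = y + 1 by omega, show j + 1 + 1 = j + 2 by rfl] at h₂
  generalize (j + 2 + y).choose j = a at *
  generalize (j + 2 + y).choose (j + 1) = b at *
  generalize (j + 2 + y).choose (j + 2) = c at *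
  zify at h₁ h₂ ⊢
  push_cast at h
  have hpos : (0 : ℤ) < (y + 2) * (j + 2) := by positivity
  refine le_of_mul_le_mul_left ?_ hpos
  have hb : (0 : ℤ) ≤ b := by positivity
  have key : ((j : ℤ) + 1) * (j + 2) + (y + 1) * (y + 2) ≤ 2 * ((y + 2) * (j + 2)) := by
    nlinarith
  calc ((y : ℤ) + 2) * (j + 2) * (a + c)
      = (j + 2) * (a * (y + 2)) + (y + 2) * (c * (j + 2)) := by ring
    _ = b * ((j + 1) * (j + 2) + (y + 1) * (y + 2)) := by rw [← h₁, h₂]; ring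
    _ ≤ b * (2 * ((y + 2) * (j + 2))) := by gcongr
    _ = _ := by ring

lemma choose_succ_le_choose {n j : ℕ} (h : n ≤ 2 * j + 1) : n.choose (j + 1) ≤ n.choose j := by
  have h₁ := Nat.choose_succ_right_eq n j
  refine le_of_mul_le_mul_right (h₁.trans_le ?_) (Nat.succ_pos j)
  gcongr
  omega

lemma choose_le_choose_succ {n j : ℕ} (h : 2 * j + 1 ≤ n) : n.choose j ≤ n.choose (j + 1) := by
  have h₁ := Nat.choose_succ_right_eq n j
  refine le_of_mul_le_mul_right (le_trans ?_ h₁.ge) (Nat.succ_pos j)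
  gcongr
  omega

lemma choose_le_choose_of_le {n c q : ℕ} (hc : n ≤ 2 * c) (hq : c ≤ q) :
    n.choose q ≤ n.choose c := by
  induction q, hq using Nat.le_induction with
  | base => rfl
  | succ q hq ih => exact (choose_succ_le_choose (by omega)).trans ih

/-- If `a ≤ b` lie in the range of concavity above the middle layer, the last decrement of the
binomial coefficients dominates the first. -/
lemma choose_add_choose_succ_le {n a b : ℕ} (ha : n ≤ 2 * a) (hab : a ≤ b) (hb : b + 1 ≤ n)
    (h : (2 * (b : ℤ) - n) ^ 2 ≤ n) :
    n.choose a + n.choose (b + 1) ≤ n.choose (a + 1) + n.choose b := by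
  induction b, hab using Nat.le_induction with
  | base => omega
  | succ b hab ih =>
    have ih := ih (by omega) (by push_cast at h; nlinarith)
    have := choose_add_choose_le_two_mul_choose (n := n) (j := b) (by omega)
      (by push_cast at h; linarith)
    change _ + n.choose (b + 2) ≤ _
    omega

/-- Two binomial coefficients on layers averaging `c` sum to at most twice that of layer `c`. -/
lemma choose_sub_add_choose_add_le {n c d : ℕ} (hc : n ≤ 2 * c) (hd : d ≤ c)
    (hn : (2 * (2 * (c : ℤ) - n)) ^ 2 ≤ n) :
    n.choose (c - d) + n.choose (c + d) ≤ 2 * n.choose c := by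
  induction d with
  | zero => simp; omega
  | succ d ih =>
    refine le_trans ?_ (ih (by omega))
    obtain ⟨e, rfl⟩ := Nat.exists_eq_add_of_le hd
    rw [show d + 1 + e - (d + 1) = e by omega, show d + 1 + e - d = e + 1 by omega]
    rw [← add_assoc (d + 1 + e) d 1]
    by_cases he : 2 * e + 1 ≤ n
    · exact add_le_add (choose_le_choose_succ he) (choose_succ_le_choose (by omega))
    · push_cast at hn
      have hle : 2 * (2 * ((d : ℤ) + 1 + e) - n) ≤ n := (Int.le_self_sq _).trans hn
      refine choose_add_choose_succ_le (by omega) (by omega) (by omega) (le_trans ?_ hn)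
      push_cast
      exact pow_le_pow_left₀ (by omega) (by omega) 2

lemma choose_add_choose_le {n c p q : ℕ} (hc : n ≤ 2 * c)
    (hn : (2 * (2 * (c : ℤ) - n)) ^ 2 ≤ n) (hpq : 2 * c ≤ p + q) :
    n.choose p + n.choose q ≤ 2 * n.choose c := by
  wlog h : p ≤ q generalizing p q
  · rw [add_comm]; exact this (by omega) (by omega)
  rcases le_total c p with hp | hp
  · have := choose_le_choose_of_le hc hp
    have := choose_le_choose_of_le hc (hp.trans h)
    omega
  · obtain ⟨d, rfl⟩ := Nat.exists_eq_add_of_le hp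
    have h₁ := choose_sub_add_choose_add_le hc (d := d) (by omega) hn
    have h₂ : n.choose q ≤ n.choose (p + d + d) := choose_le_choose_of_le (by omega) (by omega)
    rw [Nat.add_sub_cancel] at h₁
    omega

lemma exists_sum_eq_sum_range_card (w : ℕ → ℕ) (S : Finset ℕ) :
    ∃ p : ℕ → ℕ, ∑ x ∈ S, w x = ∑ i ∈ range #S, w (p i) ∧ ∀ i < #S, ∃ a ∈ S, a + i ≤ p i := by
  induction S using Finset.induction_on_max with
  | empty => exact ⟨id, by simp⟩
  | insert a S ha ih =>
    obtain ⟨p, hp, hp'⟩ := ih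
    have haS : a ∉ S := fun h ↦ (ha a h).false
    refine ⟨Function.update p #S a, ?_, fun i hi ↦ ?_⟩
    · rw [sum_insert haS, card_insert_of_notMem haS, sum_range_succ, Function.update_self, hp,
        add_comm]
      congr 1
      exact sum_congr rfl fun i hi ↦ by rw [Function.update_of_ne (mem_range.1 hi).ne]
    · rw [card_insert_of_notMem haS] at hi
      rcases (Nat.lt_succ_iff.1 hi).eq_or_lt with rfl | hi
      · rw [Function.update_self]
        rcases S.eq_empty_or_nonempty with rfl | hS
        · exact ⟨a, by simp⟩
        · refine ⟨S.min' hS, mem_insert_of_mem (S.min'_mem hS), ?_⟩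
          have hsub : S ⊆ Ico (S.min' hS) a := fun x hx ↦ mem_Ico.2 ⟨S.min'_le x hx, ha x hx⟩
          have hcard := card_le_card hsub
          have := ha _ (S.min'_mem hS)
          rw [Nat.card_Ico] at hcard
          omega
      · obtain ⟨b, hb, hbi⟩ := hp' i hi
        exact ⟨b, mem_insert_of_mem hb, by rwa [Function.update_of_ne hi.ne]⟩

/-- Enumerate a set of at most `k` naturals increasingly, padding by a number `N`. -/
lemma exists_sum_eq_sum_range (w : ℕ → ℕ) {N k : ℕ} (hw : w N = 0) (S : Finset ℕ) (hS : #S ≤ k) :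
    ∃ p : ℕ → ℕ, ∑ x ∈ S, w x = ∑ i ∈ range k, w (p i) ∧
      ∀ i, p i = N ∨ ∃ a ∈ S, a + i ≤ p i := by
  obtain ⟨p, hp, hp'⟩ := exists_sum_eq_sum_range_card w S
  refine ⟨fun i ↦ if i < #S then p i else N, ?_, fun i ↦ ?_⟩
  · rw [hp, ← sum_subset (range_subset_range.2 hS)]
    · exact sum_congr rfl fun i hi ↦ by simp only [if_pos (mem_range.1 hi)]
    · intro i _ hi
      simp only [if_neg (mt mem_range.2 hi), hw]
  · by_cases hi : i < #S
    · simpa [hi] using Or.inr (hp' i hi)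
    · simp [hi]

lemma sum_add_sum_le_two_mul_sum (w : ℕ → ℕ) {m k N : ℕ} (hN : 2 * (m + k) ≤ N) (hwN : w N = 0)
    (hw : ∀ i < k, ∀ p q, 2 * (m + i) ≤ p + q → w p + w q ≤ 2 * w (m + i))
    {S T : Finset ℕ} (hS : #S ≤ k) (hT : #T ≤ k) (hST : ∀ p ∈ S, ∀ q ∈ T, 2 * m ≤ p + q) :
    ∑ p ∈ S, w p + ∑ q ∈ T, w q ≤ 2 * ∑ i ∈ range k, w (m + i) := by
  obtain ⟨p, hp, hp'⟩ := exists_sum_eq_sum_range w hwN S hS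
  obtain ⟨q, hq, hq'⟩ := exists_sum_eq_sum_range w hwN T hT
  rw [hp, hq, ← sum_add_distrib, mul_sum]
  refine sum_le_sum fun i hi ↦ hw i (mem_range.1 hi) _ _ ?_
  have hi := mem_range.1 hi
  rcases hp' i with h | ⟨a, ha, hai⟩
  · omega
  rcases hq' i with h | ⟨b, hb, hbi⟩
  · omega
  have := hST a ha b hb
  omega

lemma injOn_card_of_isChain {α : Type*} {C : Finset (Finset α)}
    (hC : IsChain (· ⊆ ·) (C : Set (Finset α))) : Set.InjOn Finset.card (C : Set (Finset α)) := by
  intro A hA B hB h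
  rcases hC.total hA hB with h' | h'
  · exact eq_of_subset_of_card_le h' h.ge
  · exact (eq_of_subset_of_card_le h' h.le).symm

lemma IsKSperner.card_le_of_isChain {n k : ℕ} {F C : Finset (Finset (Fin n))}
    (hF : IsKSperner k F) (hCF : C ⊆ F) (hC : IsChain (· ⊆ ·) (C : Set (Finset (Fin n)))) :
    #C ≤ k := by
  by_contra! h
  rw [← card_image_of_injOn (injOn_card_of_isChain hC)] at h
  choose A hA hcard using fun i ↦ mem_image.1 (orderEmbOfCardLe_mem (C.image card) h i)
  refine hF ⟨A, fun i ↦ hCF (hA i), fun i j hij ↦ ?_⟩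
  have hlt : #(A i) < #(A j) := by
    rw [hcard, hcard]
    exact (orderEmbOfCardLe _ h).strictMono hij
  rcases hC.total (hA i) (hA j) with h' | h'
  · exact ssubset_of_subset_of_ne h' (by rintro h; simp [h] at hlt)
  · exact absurd (card_le_card h') hlt.not_ge

open Numbering in
lemma isChain_isPrefix {X : Type*} [Fintype X] (f : Numbering X) :
    IsChain (· ⊆ ·) {s : Finset X | IsPrefix f s} := fun s hs t ht _ ↦
  (le_total #s #t).imp (hs.subset_of_card_le_card ht) (ht.subset_of_card_le_card hs)

open Numbering in
/-- If `φ` preserves the number of numberings having a set as a prefix, then on average a numbering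
has `φ A` as a prefix for sets `A` in `F` of total binomial weight `#F`. -/
lemma sum_numbering_sum_choose {X : Type*} [Fintype X] [DecidableEq X] (F : Finset (Finset X))
    (φ : Finset X → Finset X)
    (hφ : ∀ A, (#(φ A)).factorial * (Fintype.card X - #(φ A)).factorial =
      (#A).factorial * (Fintype.card X - #A).factorial) :
    ∑ f : Numbering X, ∑ A ∈ F with IsPrefix f (φ A), (Fintype.card X).choose #A =
      #F * (Fintype.card X).factorial := by
  simp_rw [sum_filter]
  rw [sum_comm, card_eq_sum_ones, sum_mul]
  refine sum_congr rfl fun A _ ↦ ?_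
  rw [← sum_filter, sum_const, smul_eq_mul, one_mul]
  have := card_prefixed (φ A)
  rw [prefixed] at this
  rw [this, hφ, ← Nat.choose_mul_factorial_mul_factorial (card_le_univ A)]
  ring

open Numbering in
lemma TIntersecting.card_le_of_isKSperner {n t k m : ℕ} {F : Finset (Finset (Fin n))}
    (hF : TIntersecting t F) (hF' : IsKSperner k F) (hm : n + t = 2 * m)
    (ht : 0 < t) (hn : (2 * (t + 2 * k)) ^ 2 ≤ n) :
    #F ≤ ∑ i ∈ range k, n.choose (m + i) := by
  have key (f : Numbering (Fin n)) :
      ∑ A ∈ F with IsPrefix f A, n.choose #A + ∑ A ∈ F with IsPrefix f Aᶜ, n.choose #A ≤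
        2 * ∑ i ∈ range k, n.choose (m + i) := by
    have hC₁ : IsChain (· ⊆ ·) (({A ∈ F | IsPrefix f A} : Finset _) : Set (Finset (Fin n))) :=
      (isChain_isPrefix f).mono fun A hA ↦ (mem_filter.1 hA).2
    have hC₂ : IsChain (· ⊆ ·) (({A ∈ F | IsPrefix f Aᶜ} : Finset _) : Set (Finset (Fin n))) := by
      intro A hA B hB hAB
      have := isChain_isPrefix f (mem_filter.1 hA).2 (mem_filter.1 hB).2 (by simpa using hAB)
      simpa [or_comm] using this
    rw [← sum_image (f := n.choose) (injOn_card_of_isChain hC₁),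
      ← sum_image (f := n.choose) (injOn_card_of_isChain hC₂)]
    refine sum_add_sum_le_two_mul_sum n.choose (N := n + 2 * (m + k) + 1) (by omega)
      (Nat.choose_eq_zero_of_lt (by omega)) ?_
      (card_image_le.trans (hF'.card_le_of_isChain (filter_subset _ _) hC₁))
      (card_image_le.trans (hF'.card_le_of_isChain (filter_subset _ _) hC₂)) ?_
    · intro i hi p q hpq
      refine choose_add_choose_le (by omega) ?_ hpq
      have : 2 * ((m + i : ℕ) : ℤ) - n = (t + 2 * i : ℕ) := by push_cast; omega
      rw [this]
      norm_cast
      refine le_trans ?_ hn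
      gcongr
    · simp only [mem_image, mem_filter]
      rintro _ ⟨A, ⟨hA, hAf⟩, rfl⟩ _ ⟨B, ⟨hB, hBf⟩, rfl⟩
      have hAB := hF A hA B hB
      have hadd := card_union_add_card_inter A B
      have hBc := card_compl B
      have hBn := card_le_univ B
      have hAn := card_le_univ A
      rw [Fintype.card_fin] at *
      suffices t + n ≤ #A + #B by omega
      rcases le_total #A #Bᶜ with h | h
      · have h' := hAf.subset_of_card_le_card hBf h
        have : A ∩ B = ∅ := by
          rw [← disjoint_iff_inter_eq_empty]
          exact subset_compl_iff_disjoint_right.1 h'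
        rw [this, card_empty] at hAB
        omega
      · have h' := hBf.subset_of_card_le_card hAf h
        have : A ∪ B = univ := by
          rw [eq_univ_iff_forall]
          intro x
          by_cases hx : x ∈ B
          · exact mem_union_right _ hx
          · exact mem_union_left _ (h' (mem_compl.2 hx))
        rw [this, card_univ, Fintype.card_fin] at hadd
        omega
  have h₁ := sum_numbering_sum_choose F id fun _ ↦ rfl
  have h₂ := sum_numbering_sum_choose F compl fun A ↦ by
    rw [card_compl, Nat.sub_sub_self (card_le_univ A), mul_comm]
  have hsum := sum_le_sum fun f (_ : f ∈ univ) ↦ key f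
  simp only [id, Fintype.card_fin] at h₁ h₂
  rw [sum_add_distrib, h₁, h₂, sum_const, card_univ, Fintype.card_numbering, Fintype.card_fin,
    smul_eq_mul] at hsum
  refine le_of_mul_le_mul_left ?_ (Nat.factorial_pos n)
  linarith

/-- For fixed positive `t, k` there is `n₀` such that for every `n ≥ n₀`
with `t ≤ n` and `n + t` even, every `t`-intersecting `k`-Sperner family `F ⊆ 2^[n]`
satisfies `|F| ≤ ∑_{i=0}^{k-1} C(n, (n+t)/2 + i)`. -/
theorem stmt_0 (t k : ℕ) (ht : 0 < t) (hk : 0 < k) :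
    ∃ n₀ : ℕ, ∀ n : ℕ, n₀ ≤ n → t ≤ n → Even (n + t) →
      ∀ F : Finset (Finset (Fin n)), TIntersecting t F → IsKSperner k F →
        F.card ≤ ∑ i ∈ Finset.range k, n.choose ((n + t) / 2 + i) := by
  refine ⟨(2 * (t + 2 * k)) ^ 2, fun n hn _ heven F hF hF' ↦ ?_⟩
  exact hF.card_le_of_isKSperner hF' (Nat.two_mul_div_two_of_even heven).symm ht hn
end

section
/- Let n and t be positive integers with t ≤ n, let F ⊆ 2^[n] be a t-intersecting family, and let i be an integer with i ≤ ⌊(n+t-1)/2⌋. Then |∇_{i+1}(F_i)| ≥ |F_i|, where F_i = {F ∈ F : |F| = i}. -/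
open Finset

/-- If the sums of `c` over the members of a `k`-uniform family above each `(k-1)`-set vanish,
then so do the sums over the members above any set with fewer than `k` elements. -/
lemma sum_filter_superset_eq_zero {α : Type*} [DecidableEq α] [Fintype α]
    {G : Finset (Finset α)} {k : ℕ} (hG : ∀ A ∈ G, A.card = k) (c : Finset α → ℚ)
    (hc : ∀ E : Finset α, E.card + 1 = k → ∑ A ∈ G with E ⊆ A, c A = 0) :
    ∀ (m : ℕ) (J : Finset α), J.card + 1 + m = k → ∑ A ∈ G with J ⊆ A, c A = 0 := by
  intro m
  induction m with
  | zero => exact fun J hJ => hc J hJ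
  | succ m ih =>
    intro J hJ
    have hzero : ∑ x ∈ univ \ J, ∑ A ∈ G with insert x J ⊆ A, c A = 0 := by
      refine sum_eq_zero fun x hx => ih _ ?_
      rw [card_insert_of_notMem (mem_sdiff.1 hx).2]
      omega
    have hcount : ∑ x ∈ univ \ J, ∑ A ∈ G with insert x J ⊆ A, c A
        = ((m + 2 : ℕ) : ℚ) * ∑ A ∈ G with J ⊆ A, c A := by
      simp only [sum_filter]
      rw [sum_comm, mul_sum]
      refine sum_congr rfl fun A hA => ?_
      by_cases hJA : J ⊆ A
      · have hfilter : (univ \ J).filter (fun x => insert x J ⊆ A) = A \ J := by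
          ext x
          simp [insert_subset_iff, hJA, and_comm]
        have hcard : (A \ J).card = m + 2 := by
          rw [card_sdiff_of_subset hJA, hG A hA]
          omega
        rw [← sum_filter, hfilter, sum_const, hcard, nsmul_eq_mul, if_pos hJA]
      · rw [if_neg hJA, mul_zero]
        exact sum_eq_zero fun x _ => if_neg fun h => hJA ((subset_insert x J).trans h)
    rw [hcount] at hzero
    exact (mul_eq_zero.1 hzero).resolve_left (by positivity)

/-- The inclusion vectors of an intersecting uniform family over its shadow are linearly
independent. -/
lemma eq_zero_of_sum_filter_superset_eq_zero {α : Type*} [DecidableEq α] [Fintype α]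
    {G : Finset (Finset α)} {k : ℕ} (hG : ∀ A ∈ G, A.card = k)
    (hint : ∀ A ∈ G, ∀ B ∈ G, (A ∩ B).Nonempty) (c : Finset α → ℚ)
    (hc : ∀ E : Finset α, E.card + 1 = k → ∑ A ∈ G with E ⊆ A, c A = 0)
    {A : Finset α} (hA : A ∈ G) : c A = 0 := by
  have hsum : ∑ J ∈ A.powerset, (-1 : ℚ) ^ J.card * ∑ B ∈ G with J ⊆ B, c B = 0 := by
    simp only [sum_filter, mul_sum]
    rw [sum_comm]
    refine sum_eq_zero fun B hB => ?_
    have hfilter : A.powerset.filter (fun J => J ⊆ B) = (A ∩ B).powerset := by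
      ext J
      rw [mem_filter, mem_powerset, mem_powerset, subset_inter_iff]
    have halt : ∑ J ∈ (A ∩ B).powerset, (-1 : ℚ) ^ J.card = 0 := by
      exact_mod_cast congrArg (Int.cast : ℤ → ℚ)
        (sum_powerset_neg_one_pow_card_of_nonempty (hint A hA B hB))
    simp only [mul_ite, mul_zero]
    rw [← sum_filter, hfilter, ← sum_mul, halt, zero_mul]
  rw [sum_eq_single_of_mem A (mem_powerset_self A)] at hsum
  · have hfilter : G.filter (fun B => A ⊆ B) = {A} := by
      ext B
      simp only [mem_filter, mem_singleton]
      constructor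
      · rintro ⟨hB, hAB⟩
        exact (eq_of_subset_of_card_le hAB (by rw [hG A hA, hG B hB])).symm
      · rintro rfl
        exact ⟨hA, Subset.rfl⟩
    rw [hfilter, sum_singleton] at hsum
    exact (mul_eq_zero.1 hsum).resolve_left (pow_ne_zero _ (by norm_num))
  · intro J hJ hne
    have hlt := card_lt_card ((mem_powerset.1 hJ).ssubset_of_ne hne)
    rw [hG A hA] at hlt
    rw [sum_filter_superset_eq_zero hG c hc (k - J.card - 1) J (by omega), mul_zero]

/-- The shadow of an intersecting uniform family is at least as large as the family. -/
lemma card_le_card_shadow_of_intersecting {α : Type*} [DecidableEq α] [Fintype α]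
    {G : Finset (Finset α)} {k : ℕ} (hG : ∀ A ∈ G, A.card = k)
    (hint : ∀ A ∈ G, ∀ B ∈ G, (A ∩ B).Nonempty) : G.card ≤ (shadow G).card := by
  let T : (G → ℚ) →ₗ[ℚ] (shadow G → ℚ) :=
    { toFun := fun c E => ∑ A : G, if E.1 ⊆ A.1 then c A else 0
      map_add' := fun c d => by
        ext E
        simp only [Pi.add_apply, ← sum_add_distrib]
        exact sum_congr rfl fun A _ => by split_ifs <;> simp
      map_smul' := fun r c => by
        ext E
        simp [mul_sum] }
  have hT : Function.Injective T := by
    rw [injective_iff_map_eq_zero]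
    intro c hc
    let d : Finset α → ℚ := fun A => if h : A ∈ G then c ⟨A, h⟩ else 0
    have hd : ∀ E : Finset α, E.card + 1 = k → ∑ A ∈ G with E ⊆ A, d A = 0 := by
      intro E hE
      by_cases hmem : E ∈ shadow G
      · have h := congrFun hc ⟨E, hmem⟩
        rw [sum_filter, ← sum_coe_sort]
        simpa [T, d] using h
      · refine sum_eq_zero fun A hA => (hmem ?_).elim
        obtain ⟨hA, hEA⟩ := mem_filter.1 hA
        rw [mem_shadow_iff_exists_mem_card_add_one]
        exact ⟨A, hA, hEA, by rw [hG A hA, hE]⟩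
    ext A
    simpa [d] using eq_zero_of_sum_filter_superset_eq_zero hG hint d hd A.2
  simpa using LinearMap.finrank_le_finrank_of_injective hT

/-- For a `t`-intersecting family `F ⊆ 2^[n]` and `i ≤ ⌊(n+t-1)/2⌋`,
the `(i+1)`-shade of `F_i` is at least as large as `F_i`. -/
theorem stmt_1 (n t : ℕ) (hn : 0 < n) (ht : 0 < t) (htn : t ≤ n)
    (F : Finset (Finset (Fin n))) (hF : TIntersecting t F)
    (i : ℕ) (hi : i ≤ (n + t - 1) / 2) :
    (F.filter (fun A => A.card = i)).card ≤
      (Finset.univ.filter (fun B : Finset (Fin n) =>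
        B.card = i + 1 ∧ ∃ A ∈ F.filter (fun A => A.card = i), A ⊆ B)).card := by
  set Fi := F.filter (fun A => A.card = i)
  suffices hle : Fi.card ≤ (upShadow Fi).card by
    refine hle.trans (card_le_card fun B hB => ?_)
    obtain ⟨A, hA, hAB, hB⟩ := mem_upShadow_iff_exists_mem_card_add_one.1 hB
    simp only [mem_filter_univ]
    exact ⟨by rw [hB, (mem_filter.1 hA).2], A, hA, hAB⟩
  rw [← card_compls Fi, ← card_compls (upShadow Fi), ← shadow_compls]
  refine card_le_card_shadow_of_intersecting (k := n - i) ?_ ?_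
  · intro A hA
    have h := (mem_filter.1 (mem_compls.1 hA)).2
    have := card_add_card_compl A
    rw [Fintype.card_fin] at this
    omega
  · intro A hA B hB
    obtain ⟨hAF, hAi⟩ := mem_filter.1 (mem_compls.1 hA)
    obtain ⟨hBF, hBi⟩ := mem_filter.1 (mem_compls.1 hB)
    have hAB := hF _ hAF _ hBF
    have hunion := card_union_add_card_inter Aᶜ Bᶜ
    have hcompl := card_add_card_compl (A ∩ B)
    rw [compl_inter, Fintype.card_fin] at hcompl
    rw [← card_pos]
    omega
end

section
/- Let n, t, k be positive integers with t ≤ n and n+t even. If F ⊆ 2^[n] is a t-intersecting k-Sperner family, then there exists a t-intersecting k-Sperner family G ⊆ 2^[n] with |G| ≥ |F| such that every G ∈ G satisfies |G| ≥ (n+t)/2 − (k−1). -/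
open Finset

open scoped FinsetFamily

/-- A uniform intersecting family is no larger than its shadow. -/
theorem card_le_card_shadow_of_intersecting_s2 {α : Type*} [DecidableEq α]
    {𝒜 : Finset (Finset α)} {r : ℕ} (hr : (𝒜 : Set (Finset α)).Sized r)
    (hint : ∀ A ∈ 𝒜, ∀ B ∈ 𝒜, (A ∩ B).Nonempty) : #𝒜 ≤ #(∂ 𝒜) := by
  let v : 𝒜 → (∂ 𝒜 → ℚ) := fun A S => if S.1 ⊆ A.1 then 1 else 0
  suffices hv : LinearIndependent ℚ v by simpa using hv.fintype_card_le_finrank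
  rw [Fintype.linearIndependent_iff]
  intro w hw B
  have hcodim : ∀ S : Finset α, #S + 1 = r → ∑ A, w A * (if S ⊆ A.1 then 1 else 0) = 0 := by
    intro S hS
    by_cases hmem : S ∈ ∂ 𝒜
    · simpa [v, Finset.sum_apply] using congrFun hw ⟨S, hmem⟩
    · refine sum_eq_zero fun A _ => ?_
      rw [if_neg, mul_zero]
      intro hSA
      exact hmem (mem_shadow_iff_exists_mem_card_add_one.2
        ⟨A.1, A.2, hSA, by rw [hr A.2, hS]⟩)
  have hsmall : ∀ d : ℕ, ∀ J : Finset α, #J + 1 + d = r →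
      ∑ A, w A * (if J ⊆ A.1 then 1 else 0) = 0 := by
    intro d
    induction d with
    | zero => exact hcodim
    | succ d ih =>
      intro J hJ
      have hdouble : ∑ x ∈ (𝒜.biUnion id) \ J,
          ∑ A, w A * (if insert x J ⊆ A.1 then (1 : ℚ) else 0) = 0 := by
        refine sum_eq_zero fun x hx => ih _ ?_
        rw [card_insert_of_notMem (mem_sdiff.1 hx).2]
        omega
      rw [sum_comm] at hdouble
      have hcount : ∀ A : 𝒜, ∑ x ∈ (𝒜.biUnion id) \ J,
          w A * (if insert x J ⊆ A.1 then (1 : ℚ) else 0) =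
          (d + 2) * (w A * (if J ⊆ A.1 then 1 else 0)) := by
        intro A
        by_cases hJA : J ⊆ A.1
        · have hfilter : {x ∈ (𝒜.biUnion id) \ J | insert x J ⊆ A.1} = A.1 \ J := by
            ext x
            simp only [mem_filter, mem_sdiff, mem_biUnion, id, insert_subset_iff]
            exact ⟨fun h => ⟨h.2.1, h.1.2⟩, fun h => ⟨⟨⟨A.1, A.2, h.1⟩, h.2⟩, h.1, hJA⟩⟩
          have hcard : #(A.1 \ J) = d + 2 := by
            rw [card_sdiff_of_subset hJA, hr A.2]
            omega
          rw [← mul_sum, sum_boole, hfilter, hcard, if_pos hJA]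
          push_cast
          ring
        · rw [if_neg hJA]
          simp only [mul_zero]
          refine sum_eq_zero fun x _ => ?_
          rw [if_neg fun h => hJA ((subset_insert x J).trans h), mul_zero]
      rw [sum_congr rfl fun A _ => hcount A, ← mul_sum] at hdouble
      exact (mul_eq_zero.1 hdouble).resolve_left (by positivity)
  have hzero : ∑ J ∈ B.1.powerset,
      (-1 : ℚ) ^ #J * ∑ A, w A * (if J ⊆ A.1 then 1 else 0) = 0 := by
    simp_rw [mul_sum]
    rw [sum_comm]
    refine sum_eq_zero fun A _ => ?_
    have hpow : {J ∈ B.1.powerset | J ⊆ A.1} = (B.1 ∩ A.1).powerset := by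
      ext J
      simp only [mem_filter, mem_powerset, subset_inter_iff]
    have halt : ∑ J ∈ (B.1 ∩ A.1).powerset, (-1 : ℚ) ^ #J = 0 := by
      exact_mod_cast congrArg (Int.cast : ℤ → ℚ)
        (sum_powerset_neg_one_pow_card_of_nonempty (hint _ B.2 _ A.2))
    calc _ = w A * ∑ J ∈ B.1.powerset with J ⊆ A.1, (-1 : ℚ) ^ #J := by
          rw [mul_sum, sum_filter]
          refine sum_congr rfl fun J _ => ?_
          split_ifs <;> ring
      _ = 0 := by rw [hpow, halt, mul_zero]
  rw [sum_eq_single_of_mem B.1 (mem_powerset_self _)] at hzero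
  · have hB := (mul_eq_zero.1 hzero).resolve_left (by simp)
    rw [sum_eq_single_of_mem B (mem_univ _)] at hB
    · simpa using hB
    · intro A _ hAB
      rw [if_neg, mul_zero]
      intro hBA
      refine hAB (Subtype.ext (eq_of_subset_of_card_le hBA ?_).symm)
      rw [hr A.2, hr B.2]
  · intro J hJ hJB
    have hlt : #J < r := hr B.2 ▸ card_lt_card ((mem_powerset.1 hJ).ssubset_of_ne hJB)
    rw [hsmall (r - 1 - #J) J (by omega), mul_zero]

/-- A uniform family in which no two members cover the ground set is no larger than its
upper shadow. -/
theorem card_le_card_upShadow_of_union_ne_univ {α : Type*} [Fintype α] [DecidableEq α]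
    {𝒜 : Finset (Finset α)} {r : ℕ} (hr : (𝒜 : Set (Finset α)).Sized r)
    (hunion : ∀ A ∈ 𝒜, ∀ B ∈ 𝒜, A ∪ B ≠ univ) : #𝒜 ≤ #(∂⁺ 𝒜) := by
  have h := card_le_card_shadow_of_intersecting_s2 (𝒜 := 𝒜ᶜˢ) hr.compls ?_
  · simpa [shadow_compls] using h
  · intro A hA B hB
    rw [nonempty_iff_ne_empty]
    intro hAB
    refine hunion _ (mem_compls.1 hA) _ (mem_compls.1 hB) ?_
    rw [← compl_inter, hAB, compl_empty]

/-- The levels of a `t`-intersecting family below `(n + t) / 2` can be pushed up by one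
injectively. -/
theorem TIntersecting.exists_push_up {n t : ℕ} {U : Finset (Finset (Fin n))}
    (hU : TIntersecting t U) :
    ∃ φ : Finset (Fin n) → Finset (Fin n),
      (∀ A ∈ U, 2 * #A + 2 ≤ n + t → A ⊆ φ A ∧ #(φ A) = #A + 1) ∧
      ∀ A ∈ U, ∀ B ∈ U, 2 * #A + 2 ≤ n + t → 2 * #B + 2 ≤ n + t → φ A = φ B → A = B := by
  have hlevel : ∀ l : ℕ, ∃ ψ : Finset (Fin n) → Finset (Fin n), 2 * l + 2 ≤ n + t →
      (∀ A ∈ U, #A = l → A ⊆ ψ A ∧ #(ψ A) = #A + 1) ∧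
      ∀ A ∈ U, ∀ B ∈ U, #A = l → #B = l → ψ A = ψ B → A = B := by
    intro l
    by_cases hl : 2 * l + 2 ≤ n + t
    swap
    · exact ⟨id, fun h => absurd h hl⟩
    obtain ⟨f, hf, hfmem⟩ := (Finset.all_card_le_biUnion_card_iff_exists_injective
      (fun A : {A // A ∈ U ∧ #A = l} => ∂⁺ {A.1})).1 (by
        intro s
        have hsized : ((s.map (Function.Embedding.subtype _) : Finset (Finset (Fin n))) :
            Set (Finset (Fin n))).Sized l := by
          intro A hA
          obtain ⟨A', -, rfl⟩ := mem_map.1 (mem_coe.1 hA)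
          exact A'.2.2
        have h := card_le_card_upShadow_of_union_ne_univ hsized (by
          intro A hA B hB hAB
          obtain ⟨A', -, rfl⟩ := mem_map.1 hA
          obtain ⟨B', -, rfl⟩ := mem_map.1 hB
          have h1 := hU _ A'.2.1 _ B'.2.1
          have h2 := card_union_add_card_inter A'.1 B'.1
          have h3 : #(A'.1 ∪ B'.1) = n := by
            have := congrArg card hAB
            simpa using this
          rw [A'.2.2, B'.2.2] at h2
          omega)
        rw [card_map] at h
        refine h.trans (card_le_card fun S hS => ?_)
        obtain ⟨A, hA, x, hx, rfl⟩ := mem_upShadow_iff.1 hS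
        obtain ⟨A', hA', rfl⟩ := mem_map.1 hA
        exact mem_biUnion.2 ⟨A', hA', mem_upShadow_iff.2 ⟨_, mem_singleton_self _, x, hx, rfl⟩⟩)
    refine ⟨fun A => if h : A ∈ U ∧ #A = l then f ⟨A, h⟩ else A, fun _ => ⟨?_, ?_⟩⟩
    · intro A hA hAl
      have h : A ∈ U ∧ #A = l := ⟨hA, hAl⟩
      obtain ⟨B, hB, x, hx, hins⟩ := mem_upShadow_iff.1 (hfmem ⟨A, h⟩)
      obtain rfl := mem_singleton.1 hB
      simp only [dif_pos h]
      rw [← hins]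
      exact ⟨subset_insert _ _, card_insert_of_notMem hx⟩
    · intro A hA B hB hAl hBl hAB
      simp only [dif_pos (show A ∈ U ∧ #A = l from ⟨hA, hAl⟩),
        dif_pos (show B ∈ U ∧ #B = l from ⟨hB, hBl⟩)] at hAB
      exact congrArg Subtype.val (hf hAB)
  choose ψ hψ using hlevel
  refine ⟨fun A => ψ #A A, fun A hA hAt => (hψ _ hAt).1 A hA rfl, ?_⟩
  intro A hA B hB hAt hBt hAB
  have hcard : #A = #B := by
    have h1 := ((hψ _ hAt).1 A hA rfl).2
    have h2 := ((hψ _ hBt).1 B hB rfl).2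
    simp only at hAB
    rw [hAB, h2] at h1
    omega
  simp only [← hcard] at hAB
  exact (hψ _ hAt).2 A hA B hB rfl hcard.symm hAB

/-- The smallest level of a `t`-intersecting `k`-Sperner family can be removed, as long as it
lies at least `k` levels below `(n + t) / 2`. -/
theorem exists_card_le_of_forall_le_card {n t k m : ℕ} {F : Finset (Finset (Fin n))}
    (hint : TIntersecting t F) (hsp : IsKSperner k F) (hm : 2 * m + 2 * k ≤ n + t)
    (hF : ∀ A ∈ F, m ≤ #A) :
    ∃ G : Finset (Finset (Fin n)), TIntersecting t G ∧ IsKSperner k G ∧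
      #F ≤ #G ∧ ∀ A ∈ G, m + 1 ≤ #A := by
  set U : Finset (Finset (Fin n)) := {A | ∃ B ∈ F, B ⊆ A} with hUdef
  have hUmem : ∀ {A}, A ∈ U ↔ ∃ B ∈ F, B ⊆ A := by simp [hUdef]
  have hFU : F ⊆ U := fun A hA => hUmem.2 ⟨A, hA, Subset.rfl⟩
  have hU : TIntersecting t U := by
    intro A hA B hB
    obtain ⟨A', hA', hAA⟩ := hUmem.1 hA
    obtain ⟨B', hB', hBB⟩ := hUmem.1 hB
    exact (hint _ hA' _ hB').trans (card_le_card (inter_subset_inter hAA hBB))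
  obtain ⟨φ, hφ, hφinj⟩ := hU.exists_push_up
  have horbit : ∀ A ∈ F, #A = m → ∀ i ≤ k, φ^[i] A ∈ U ∧ #(φ^[i] A) = m + i := by
    intro A hA hAm i
    induction i with
    | zero => exact fun _ => ⟨hFU hA, hAm⟩
    | succ i ih =>
      intro hi
      obtain ⟨hmem, hcard⟩ := ih (by omega)
      obtain ⟨hsub, hcard'⟩ := hφ _ hmem (by omega)
      rw [Function.iterate_succ_apply']
      obtain ⟨B, hB, hBA⟩ := hUmem.1 hmem
      exact ⟨hUmem.2 ⟨B, hB, hBA.trans hsub⟩, by omega⟩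
  have hmono : ∀ A ∈ F, #A = m → ∀ i j, i < j → j ≤ k → φ^[i] A ⊂ φ^[j] A := by
    intro A hA hAm i j hij
    induction j, hij using Nat.le_induction with
    | base =>
      intro hi
      obtain ⟨hmem, hcard⟩ := horbit A hA hAm i (by omega)
      obtain ⟨hsub, hcard'⟩ := hφ _ hmem (by omega)
      rw [Function.iterate_succ_apply']
      exact hsub.ssubset_of_ne fun h => by rw [← h] at hcard'; omega
    | succ j _ ih =>
      intro hj
      obtain ⟨hmem, hcard⟩ := horbit A hA hAm j (by omega)
      obtain ⟨hsub, -⟩ := hφ _ hmem (by omega)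
      rw [Function.iterate_succ_apply']
      exact (ih (by omega)).trans_subset hsub
  have hinj : ∀ A ∈ F, #A = m → ∀ B ∈ F, #B = m → ∀ i ≤ k, φ^[i] A = φ^[i] B → A = B := by
    intro A hA hAm B hB hBm i
    induction i with
    | zero => exact fun _ h => h
    | succ i ih =>
      intro hi h
      rw [Function.iterate_succ_apply', Function.iterate_succ_apply'] at h
      obtain ⟨hA1, hA2⟩ := horbit A hA hAm i (by omega)
      obtain ⟨hB1, hB2⟩ := horbit B hB hBm i (by omega)
      exact ih (by omega) (hφinj _ hA1 _ hB1 (by omega) (by omega) h)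
  have hexit : ∀ A, ∃ j, A ∈ F → #A = m →
      j ≤ k ∧ φ^[j] A ∉ F ∧ ∀ i < j, φ^[i] A ∈ F := by
    intro A
    by_cases hA : A ∈ F ∧ #A = m
    swap
    · exact ⟨0, fun h1 h2 => absurd ⟨h1, h2⟩ hA⟩
    have hex : ∃ j, j ≤ k ∧ φ^[j] A ∉ F := by
      by_contra! hall
      exact hsp ⟨fun i => φ^[i] A, fun i => hall i (by omega),
        fun i j hij => hmono A hA.1 hA.2 i j hij (by omega)⟩
    classical
    refine ⟨Nat.find hex, fun _ _ => ⟨(Nat.find_spec hex).1, (Nat.find_spec hex).2, ?_⟩⟩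
    intro i hi
    by_contra hiF
    exact Nat.find_min hex hi ⟨hi.le.trans (Nat.find_spec hex).1, hiF⟩
  choose e he using hexit
  set M := {A ∈ F | #A = m}
  set N := M.image fun A => φ^[e A] A
  have hN : ∀ S ∈ N, ∃ A ∈ F, #A = m ∧ φ^[e A] A = S := by
    intro S hS
    obtain ⟨A, hA, rfl⟩ := mem_image.1 hS
    exact ⟨A, (mem_filter.1 hA).1, (mem_filter.1 hA).2, rfl⟩
  have hNF : ∀ S ∈ N, S ∉ F := by
    intro S hS
    obtain ⟨A, hA, hAm, rfl⟩ := hN S hS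
    exact (he A hA hAm).2.1
  have hNcard : #N = #M := by
    refine card_image_of_injOn fun A hA B hB hAB => ?_
    obtain ⟨hA, hAm⟩ := mem_filter.1 (mem_coe.1 hA)
    obtain ⟨hB, hBm⟩ := mem_filter.1 (mem_coe.1 hB)
    have h1 := (horbit A hA hAm _ (he A hA hAm).1).2
    have h2 := (horbit B hB hBm _ (he B hB hBm).1).2
    have heq : e A = e B := by rw [hAB, h2] at h1; omega
    rw [← heq] at hAB
    exact hinj A hA hAm B hB hBm _ (he A hA hAm).1 hAB
  have hGcard : ∀ A ∈ F \ M ∪ N, m + 1 ≤ #A := by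
    intro S hS
    rcases mem_union.1 hS with hS | hS
    · obtain ⟨hSF, hSM⟩ := mem_sdiff.1 hS
      have hne : #S ≠ m := fun h => hSM (mem_filter.2 ⟨hSF, h⟩)
      have := hF S hSF
      omega
    · obtain ⟨A, hA, hAm, rfl⟩ := hN S hS
      obtain ⟨hk, hnot, -⟩ := he A hA hAm
      have hpos : e A ≠ 0 := by
        intro h0
        rw [h0] at hnot
        exact hnot hA
      rw [(horbit A hA hAm _ hk).2]
      omega
  refine ⟨F \ M ∪ N, ?_, ?_, ?_, hGcard⟩
  · have hGU : F \ M ∪ N ⊆ U := by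
      refine union_subset (sdiff_subset.trans hFU) fun S hS => ?_
      obtain ⟨A, hA, hAm, rfl⟩ := hN S hS
      exact (horbit A hA hAm _ (he A hA hAm).1).1
    exact fun A hA B hB => hU A (hGU hA) B (hGU hB)
  · rintro ⟨c, hc, hlt⟩
    by_cases hall : ∀ i, c i ∈ F
    · exact hsp ⟨c, hall, hlt⟩
    push Not at hall
    -- Below the last set of the chain outside `F`, use the orbit leading to that set.
    obtain ⟨p, hp, hpmax⟩ : ∃ p, c p ∉ F ∧ ∀ i, p < i → c i ∈ F := by
      obtain ⟨q, hq⟩ := hall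
      obtain ⟨p, hp, hmax⟩ := exists_max_image ({i | c i ∉ F} : Finset (Fin (k + 1))) id
        ⟨q, by simpa using hq⟩
      refine ⟨p, by simpa using hp, fun i hi => ?_⟩
      by_contra hiF
      exact absurd (hmax i (by simpa using hiF)) (not_le.2 hi)
    have hpN : c p ∈ N := (mem_union.1 (hc p)).resolve_left fun h => hp (mem_sdiff.1 h).1
    obtain ⟨A, hA, hAm, hAp⟩ := hN _ hpN
    obtain ⟨hk, -, hbelow⟩ := he A hA hAm
    have hgrow : ∀ i (hi : i < k + 1), m + 1 + i ≤ #(c ⟨i, hi⟩) := by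
      intro i
      induction i with
      | zero => exact fun _ => hGcard _ (hc _)
      | succ i ih =>
        intro hi
        have h1 := ih (by omega)
        have h2 := card_lt_card (hlt ⟨i, by omega⟩ ⟨i + 1, hi⟩ (by simp))
        omega
    have hpe : p.1 < e A := by
      have h1 := hgrow p.1 p.2
      have h2 := (horbit A hA hAm _ hk).2
      rw [hAp] at h2
      simp only [Fin.eta] at h1
      omega
    refine hsp ⟨fun i => if i ≤ p then φ^[i] A else c i, fun i => ?_, fun i j hij => ?_⟩
    · dsimp only
      split_ifs with h
      · exact hbelow _ (lt_of_le_of_lt h hpe)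
      · exact hpmax i (not_le.1 h)
    · dsimp only
      split_ifs with hi hj hj
      · exact hmono A hA hAm _ _ hij (by omega)
      · have h1 := hmono A hA hAm i (e A) (lt_of_le_of_lt hi hpe) hk
        rw [hAp] at h1
        exact h1.trans (hlt _ _ (not_le.1 hj))
      · exact absurd (hij.le.trans hj) hi
      · exact hlt i j hij
  · have hdisj : Disjoint (F \ M) N :=
      disjoint_left.2 fun S hS hSN => hNF S hSN (mem_sdiff.1 hS).1
    rw [card_union_of_disjoint hdisj, hNcard, card_sdiff_add_card_eq_card (filter_subset _ _)]

/-- If `n + t` is even and `F ⊆ 2^[n]` is `t`-intersecting `k`-Sperner,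
then there is a `t`-intersecting `k`-Sperner `G` with `|G| ≥ |F|` all of whose members
have size at least `(n+t)/2 - (k-1)`. -/
theorem stmt_2 (n t k : ℕ) (hn : 0 < n) (ht : 0 < t) (hk : 0 < k)
    (htn : t ≤ n) (hpar : Even (n + t))
    (F : Finset (Finset (Fin n))) (hint : TIntersecting t F) (hsp : IsKSperner k F) :
    ∃ G : Finset (Finset (Fin n)), TIntersecting t G ∧ IsKSperner k G ∧
      F.card ≤ G.card ∧ ∀ A ∈ G, ((n + t) / 2 : ℤ) - (k - 1) ≤ A.card := by
  have hlift : ∀ m : ℕ, 2 * m + 2 * k ≤ n + t + 2 → ∃ G : Finset (Finset (Fin n)),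
      TIntersecting t G ∧ IsKSperner k G ∧ #F ≤ #G ∧ ∀ A ∈ G, m ≤ #A := by
    intro m
    induction m with
    | zero => exact fun _ => ⟨F, hint, hsp, le_rfl, fun _ _ => Nat.zero_le _⟩
    | succ m ih =>
      intro hm
      obtain ⟨G, hG1, hG2, hG3, hG4⟩ := ih (by omega)
      obtain ⟨H, hH1, hH2, hH3, hH4⟩ :=
        exists_card_le_of_forall_le_card hG1 hG2 (by omega) hG4
      exact ⟨H, hH1, hH2, hG3.trans hH3, hH4⟩
  obtain ⟨s, hs⟩ := hpar
  by_cases hks : k ≤ s + 1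
  · obtain ⟨G, hG1, hG2, hG3, hG4⟩ := hlift (s + 1 - k) (by omega)
    refine ⟨G, hG1, hG2, hG3, fun A hA => ?_⟩
    have := hG4 A hA
    omega
  · exact ⟨F, hint, hsp, le_rfl, fun A _ => by omega⟩
end

section
/- Let F ⊆ 2^[n] be an antichain and let m be an integer with m > n/2 such that every member of F has size at least m. Then for every integer j with ⌊n/2⌋ ≤ j ≤ m, we have |Δ_j(F)| ≥ |F|. -/
open Finset

/-- Past the middle, the binomial coefficients of a fixed row decrease. -/
theorem choose_antitone_of_half_le {n j : ℕ} (hj : n / 2 ≤ j) {s : ℕ} (hs : j ≤ s) :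
    n.choose s ≤ n.choose j := by
  induction s, hs using Nat.le_induction with
  | base => exact le_rfl
  | succ k hk ih =>
    refine le_trans ?_ ih
    have h := Nat.choose_succ_right_eq n k
    have hle : n.choose k * (n - k) ≤ n.choose k * (k + 1) := Nat.mul_le_mul_left _ (by omega)
    exact Nat.le_of_mul_le_mul_right (h.le.trans hle) k.succ_pos

/-- An antichain whose members all have size at least `j ≥ ⌊n/2⌋` is no larger than the family of
`j`-sets lying below it. -/
theorem card_le_card_falling {α : Type*} [Fintype α] [DecidableEq α] {F : Finset (Finset α)}
    (hF : IsAntichain (· ⊆ ·) (F : Set (Finset α))) {j : ℕ} (hj : Fintype.card α / 2 ≤ j)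
    (hsize : ∀ A ∈ F, j ≤ #A) : #F ≤ #(falling j F) := by
  obtain rfl | ⟨A₀, hA₀⟩ := F.eq_empty_or_nonempty
  · simp
  set n := Fintype.card α with hn
  have hjn : j ≤ n := (hsize A₀ hA₀).trans A₀.card_le_univ
  have hpos : (0 : ℚ) < n.choose j := mod_cast Nat.choose_pos hjn
  have hlym := le_card_falling_div_choose (𝕜 := ℚ) (k := n - j) (Nat.sub_le _ _) hF
  rw [← hn, Nat.sub_sub_self hjn] at hlym
  have hcard : #F = ∑ r ∈ range (n - j + 1), #(F # (n - r)) := by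
    rw [card_eq_sum_card_fiberwise (f := fun A => n - #A) (t := range (n - j + 1))]
    · refine sum_congr rfl fun r hr => congrArg card (filter_congr fun A _ => ?_)
      have := A.card_le_univ
      have := mem_range.1 hr
      omega
    · intro A hA
      have := hsize A hA
      simp only [coe_range, Set.mem_Iio]
      omega
  have hsum : (#F : ℚ) / n.choose j ≤
      ∑ r ∈ range (n - j + 1), (#(F # (n - r)) : ℚ) / n.choose (n - r) := by
    rw [hcard, Nat.cast_sum, sum_div]
    refine sum_le_sum fun r hr => div_le_div_of_nonneg_left (by positivity) ?_ ?_
    · exact mod_cast Nat.choose_pos (Nat.sub_le _ _)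
    · have := mem_range.1 hr
      exact mod_cast choose_antitone_of_half_le hj (by omega)
  exact mod_cast (div_le_div_iff_of_pos_right hpos).1 (hsum.trans hlym)

/-- If `F ⊆ 2^[n]` is an antichain whose members all have size at least
`m > n/2`, then for every `⌊n/2⌋ ≤ j ≤ m` the `j`-shadow of `F` is at least as large as `F`. -/
theorem stmt_3 (n : ℕ) (hn : 0 < n) (F : Finset (Finset (Fin n)))
    (hanti : ∀ A ∈ F, ∀ B ∈ F, A ⊂ B → False)
    (m : ℕ) (hm : n < 2 * m) (hsize : ∀ A ∈ F, m ≤ A.card)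
    (j : ℕ) (hj1 : n / 2 ≤ j) (hj2 : j ≤ m) :
    F.card ≤ (Finset.univ.filter (fun B : Finset (Fin n) =>
      B.card = j ∧ ∃ A ∈ F, B ⊆ A)).card := by
  have hF : IsAntichain (· ⊆ ·) (F : Set (Finset (Fin n))) := fun A hA B hB hne hAB =>
    hanti A hA B hB (hAB.ssubset_of_ne hne)
  refine (card_le_card_falling hF (by simpa using hj1)
    fun A hA => hj2.trans (hsize A hA)).trans (card_le_card fun B hB => ?_)
  obtain ⟨hBA, hBj⟩ := mem_falling.1 hB
  exact mem_filter.2 ⟨mem_univ B, hBj, hBA⟩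
end

section
/- Let n, t, k be positive integers with t ≤ n and n+t even, and let c ≥ 0 be an integer. If F ⊆ 2^[n] is a nonempty t-intersecting k-Sperner family with min{|F| : F ∈ F} = (n+t)/2 − c, then there exists a t-intersecting k-Sperner family F' ⊆ 2^[n] with |F'| ≥ |F|, min{|F'| : F' ∈ F'} = (n+t)/2 − c, and max{|F'| : F' ∈ F'} ≤ (n+t)/2 + c + k − 1. -/
open Finset

/-- Binomial coefficients decrease above the middle. -/
lemma choose_le_choose_of_half_le {n a s : ℕ} (ha : n ≤ 2 * a) (has : a ≤ s) :
    n.choose s ≤ n.choose a := by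
  induction s, has using Nat.le_induction with
  | base => exact le_rfl
  | succ s hs ih =>
    refine le_trans ?_ ih
    refine Nat.le_of_mul_le_mul_right ?_ (Nat.succ_pos s)
    rw [Nat.choose_succ_right_eq]
    exact Nat.mul_le_mul_left _ (by omega)

/-- An antichain of sets all of size at least `a`, with `a` at least half the size of the ground
set, is no larger than the family of `a`-sets below it. -/
lemma card_le_card_falling_s4 {α : Type*} [Fintype α] [DecidableEq α] {a : ℕ}
    {U : Finset (Finset α)} (hU : IsAntichain (· ⊆ ·) (U : Set (Finset α)))
    (ha : Fintype.card α ≤ 2 * a) (hUa : ∀ A ∈ U, a ≤ A.card) :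
    U.card ≤ (falling a U).card := by
  set N := Fintype.card α with hN
  rcases U.eq_empty_or_nonempty with rfl | ⟨A, hA⟩
  · simp
  have haN : a ≤ N := (hUa A hA).trans (card_le_univ A)
  have hsum : U.card = ∑ r ∈ range (N - a + 1), (U.slice (N - r)).card := by
    rw [card_eq_sum_card_fiberwise (f := fun A => N - A.card) (t := range (N - a + 1))]
    · refine sum_congr rfl fun r hr => congrArg card ?_
      rw [mem_range] at hr
      ext B
      simp only [mem_filter, mem_slice]
      have hB := card_le_univ B
      exact and_congr_right fun h => by have := hUa B h; omega
    · intro B hB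
      have := hUa B hB
      simp only [coe_range, Set.mem_Iio]
      omega
  have hfall := le_card_falling_div_choose (𝕜 := ℚ) (k := N - a) (Nat.sub_le _ _) hU
  rw [← hN, Nat.sub_sub_self haN] at hfall
  have hpos : (0 : ℚ) < N.choose a := by exact_mod_cast Nat.choose_pos haN
  have hle : (U.card : ℚ) / N.choose a ≤ (falling a U).card / N.choose a := by
    refine le_trans ?_ hfall
    rw [hsum, Nat.cast_sum, sum_div]
    refine sum_le_sum fun r hr => ?_
    rw [mem_range] at hr
    have hr' : (0 : ℚ) < N.choose (N - r) := by
      exact_mod_cast Nat.choose_pos (Nat.sub_le _ _)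
    have : (N.choose (N - r) : ℚ) ≤ N.choose a := by
      exact_mod_cast choose_le_choose_of_half_le ha (by omega)
    gcongr
  rw [div_le_div_iff_of_pos_right hpos] at hle
  exact_mod_cast hle

/-- The family obtained from `L` by replacing its members of size at least `a` by the `a`-sets
below them. -/
def pushDown {α : Type*} [DecidableEq α] (a : ℕ) (L : Finset (Finset α)) : Finset (Finset α) :=
  {A ∈ L | A.card < a} ∪ falling a {A ∈ L | a ≤ A.card}

section pushDown

variable {α : Type*} [DecidableEq α] {a : ℕ} {L : Finset (Finset α)} {A : Finset α}

lemma mem_pushDown :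
    A ∈ pushDown a L ↔ A ∈ L ∧ A.card < a ∨ A.card = a ∧ ∃ B ∈ L, A ⊆ B := by
  simp only [pushDown, mem_union, mem_filter, mem_falling]
  refine or_congr_right ⟨?_, ?_⟩
  · rintro ⟨⟨B, hB, hAB⟩, hA⟩
    exact ⟨hA, B, hB.1, hAB⟩
  · rintro ⟨hA, B, hB, hAB⟩
    exact ⟨⟨B, ⟨hB, hA ▸ card_le_card hAB⟩, hAB⟩, hA⟩

lemma card_le_of_mem_pushDown (h : A ∈ pushDown a L) : A.card ≤ a := by
  rcases mem_pushDown.1 h with h | h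
  · exact h.2.le
  · exact h.1.le

lemma mem_pushDown_of_card_le (hA : A ∈ L) (ha : A.card ≤ a) : A ∈ pushDown a L :=
  mem_pushDown.2 <| ha.lt_or_eq.imp (fun h => ⟨hA, h⟩) fun h => ⟨h, A, hA, subset_rfl⟩

lemma exists_superset_of_mem_pushDown (h : A ∈ pushDown a L) : ∃ B ∈ L, A ⊆ B := by
  rcases mem_pushDown.1 h with h | h
  · exact ⟨A, h.1, subset_rfl⟩
  · exact h.2

lemma isAntichain_pushDown (hL : IsAntichain (· ⊆ ·) (L : Set (Finset α))) :
    IsAntichain (· ⊆ ·) (pushDown a L : Set (Finset α)) := by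
  intro A hA B hB hne hAB
  have hlt : A.card < B.card := card_lt_card (hAB.ssubset_of_ne hne)
  obtain ⟨C, hC, hBC⟩ := exists_superset_of_mem_pushDown hB
  have hBa := card_le_of_mem_pushDown hB
  rcases mem_pushDown.1 hA with h | h
  · refine hL h.1 hC ?_ (hAB.trans hBC)
    rintro rfl
    exact hne (hAB.antisymm hBC)
  · omega

lemma card_le_card_pushDown [Fintype α] (hL : IsAntichain (· ⊆ ·) (L : Set (Finset α)))
    (ha : Fintype.card α ≤ 2 * a) : L.card ≤ (pushDown a L).card := by
  rw [pushDown, card_union_of_disjoint, ← card_filter_add_card_filter_not (fun A => A.card < a)]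
  · simp only [not_lt]
    exact Nat.add_le_add_left (card_le_card_falling_s4
      (hL.subset (coe_subset.2 (filter_subset _ L))) ha fun A hA => (mem_filter.1 hA).2) _
  · rw [disjoint_left]
    intro A hA hA'
    have := (mem_falling.1 hA').2
    have := (mem_filter.1 hA).2
    omega

end pushDown

/-- A `k`-Sperner family splits into `k` antichains such that every member of a layer contains
a member of each earlier layer. -/
lemma IsKSperner.exists_layers {n k : ℕ} {F : Finset (Finset (Fin n))} (hF : IsKSperner k F) :
    ∃ L : ℕ → Finset (Finset (Fin n)),
      F = (range k).biUnion L ∧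
      (∀ i, IsAntichain (· ⊆ ·) (L i : Set (Finset (Fin n)))) ∧
      ∀ i j, i < j → ∀ A ∈ L j, ∃ B ∈ L i, B ⊂ A := by
  classical
  have hlt : ∀ x : F, Order.height x < k := by
    intro x
    by_contra! h
    obtain ⟨p, -, hp⟩ := Order.exists_series_of_le_height x h
    subst hp
    exact hF ⟨fun i => (p i : Finset (Fin n)), fun i => (p i).2,
      fun i j hij => p.strictMono hij⟩
  have htop : ∀ x : F, Order.height x < ⊤ := fun x => (hlt x).trans_le le_top
  refine ⟨fun i => {A ∈ F | ∃ hA : A ∈ F, Order.height (⟨A, hA⟩ : F) = i}, ?_, ?_, ?_⟩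
  · ext A
    simp only [mem_biUnion, mem_range, mem_filter]
    refine ⟨fun hA => ?_, fun ⟨_, _, hA, _⟩ => hA⟩
    obtain ⟨i, hi⟩ := ENat.ne_top_iff_exists.1 (htop ⟨A, hA⟩).ne
    refine ⟨i, ?_, hA, hA, hi.symm⟩
    have := hlt ⟨A, hA⟩
    rw [← hi] at this
    exact_mod_cast this
  · intro i A hA B hB hne hAB
    obtain ⟨-, hA, hAi⟩ := mem_filter.1 hA
    obtain ⟨-, hB, hBi⟩ := mem_filter.1 hB
    have : (⟨A, hA⟩ : F) < ⟨B, hB⟩ := hAB.ssubset_of_ne hne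
    exact (Order.height_strictMono this (htop _)).ne (hAi.trans hBi.symm)
  · intro i j hij A hA
    obtain ⟨-, hA, hAj⟩ := mem_filter.1 hA
    have : (i : ℕ∞) < Order.height (⟨A, hA⟩ : F) := by
      rw [hAj]
      exact_mod_cast hij
    obtain ⟨B, hBA, hB⟩ := (Order.coe_lt_height_iff (htop _)).1 this
    exact ⟨B, mem_filter.2 ⟨B.2, B.2, hB⟩, hBA⟩

/-- A union of `k` antichains is `k`-Sperner. -/
lemma isKSperner_biUnion {n k : ℕ} {L : ℕ → Finset (Finset (Fin n))}
    (hL : ∀ i, IsAntichain (· ⊆ ·) (L i : Set (Finset (Fin n)))) :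
    IsKSperner k ((range k).biUnion L) := by
  rintro ⟨c, hc, hlt⟩
  simp only [mem_biUnion] at hc
  choose f hf hfL using hc
  obtain ⟨i, -, j, -, hij, hfij⟩ := exists_ne_map_eq_of_card_lt_of_maps_to
    (s := univ) (t := range k) (f := f) (by simp) (fun i _ => hf i)
  wlog h : i < j generalizing i j
  · exact this j i hij.symm hfij.symm (lt_of_le_of_ne (not_lt.1 h) hij.symm)
  exact hL (f i) (hfL i) (hfij ▸ hfL j) (hlt i j h).ne (hlt i j h).subset

/-- If `n + t` is even and `F ⊆ 2^[n]` is a nonempty `t`-intersecting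
`k`-Sperner family whose minimum member size is `(n+t)/2 - c`, then there is a
`t`-intersecting `k`-Sperner `F'` with `|F'| ≥ |F|`, the same minimum size, and
maximum size at most `(n+t)/2 + c + k - 1`. -/
theorem stmt_4 (n t k : ℕ) (hn : 0 < n) (ht : 0 < t) (hk : 0 < k)
    (htn : t ≤ n) (hpar : Even (n + t)) (c : ℕ)
    (F : Finset (Finset (Fin n))) (hne : F.Nonempty)
    (hint : TIntersecting t F) (hsp : IsKSperner k F)
    (hminlb : ∀ A ∈ F, ((n + t) / 2 : ℤ) - c ≤ A.card)
    (hminatt : ∃ A ∈ F, (A.card : ℤ) = ((n + t) / 2 : ℤ) - c) :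
    ∃ F' : Finset (Finset (Fin n)), TIntersecting t F' ∧ IsKSperner k F' ∧
      F.card ≤ F'.card ∧
      (∀ A ∈ F', ((n + t) / 2 : ℤ) - c ≤ A.card) ∧
      (∃ A ∈ F', (A.card : ℤ) = ((n + t) / 2 : ℤ) - c) ∧
      ∀ A ∈ F', (A.card : ℤ) ≤ ((n + t) / 2 : ℤ) + c + k - 1 := by
  obtain ⟨m, hm⟩ := hpar
  have hm' : ((n + t) / 2 : ℤ) = m := by omega
  rw [hm'] at hminlb hminatt ⊢
  obtain ⟨L, hFL, hanti, hbelow⟩ := hsp.exists_layers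
  have hLF : ∀ i < k, L i ⊆ F := fun i hi => by
    rw [hFL]
    exact subset_biUnion_of_mem L (mem_range.2 hi)
  have hmem : ∀ A ∈ (range k).biUnion (fun i => pushDown (m + c + i) (L i)),
      A ∈ F ∨ m + c ≤ A.card := by
    intro A hA
    obtain ⟨i, hi, hA⟩ := mem_biUnion.1 hA
    rcases mem_pushDown.1 hA with h | h
    · exact Or.inl (hLF i (mem_range.1 hi) h.1)
    · exact Or.inr (by omega)
  have hmin : ∀ A ∈ (range k).biUnion (fun i => pushDown (m + c + i) (L i)),
      (m : ℤ) - c ≤ A.card := by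
    intro A hA
    rcases hmem A hA with h | h
    · exact hminlb A h
    · omega
  refine ⟨(range k).biUnion fun i => pushDown (m + c + i) (L i), ?_,
    isKSperner_biUnion fun i => isAntichain_pushDown (hanti i), ?_, hmin, ?_, ?_⟩
  · intro A hA B hB
    by_cases hAB : A ∈ F ∧ B ∈ F
    · exact hint A hAB.1 B hAB.2
    have h1 := card_union_add_card_inter A B
    have h2 := card_le_univ (A ∪ B)
    rw [Fintype.card_fin] at h2
    have h3 := hmin A hA
    have h4 := hmin B hB
    have h5 := hmem A hA
    have h6 := hmem B hB
    have h7 : m + c ≤ A.card ∨ m + c ≤ B.card := by tauto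
    omega
  · rw [card_biUnion]
    · calc F.card ≤ ∑ i ∈ range k, (L i).card := by
            rw [hFL]
            exact card_biUnion_le
        _ ≤ _ := sum_le_sum fun i _ =>
            card_le_card_pushDown (hanti i) (by rw [Fintype.card_fin]; omega)
    · intro i hi j hj hij
      wlog h : i < j generalizing i j
      · exact (this hj hi hij.symm (by omega)).symm
      refine disjoint_left.2 fun A hAi hAj => ?_
      have hA := card_le_of_mem_pushDown hAi
      obtain ⟨B, hB, hAB⟩ := exists_superset_of_mem_pushDown hAi
      rcases mem_pushDown.1 hAj with hj | hj
      · obtain ⟨C, hC, hCA⟩ := hbelow i j h A hj.1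
        exact hanti i hC hB (hCA.trans_subset hAB).ne (hCA.subset.trans hAB)
      · omega
  · obtain ⟨A, hA, hAc⟩ := hminatt
    refine ⟨A, ?_, hAc⟩
    rw [hFL] at hA
    obtain ⟨i, hi, hA⟩ := mem_biUnion.1 hA
    exact mem_biUnion.2 ⟨i, hi, mem_pushDown_of_card_le hA (by omega)⟩
  · intro A hA
    obtain ⟨i, hi, hA⟩ := mem_biUnion.1 hA
    have := card_le_of_mem_pushDown hA
    rw [mem_range] at hi
    omega
end

section
/- Let n, t, k be positive integers with t ≤ n and n+t even. For every nonempty t-intersecting k-Sperner family F ⊆ 2^[n] there exist a t-intersecting k-Sperner family F'' ⊆ 2^[n] and an integer m with 0 ≤ m ≤ k−1 such that |F''| ≥ |F|, min{|F| : F ∈ F''} = (n+t)/2 − m, and max{|F| : F ∈ F''} ≤ (n+t)/2 + k − 1 + m. -/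
open Finset

open scoped FinsetFamily

section Shadow

variable {α : Type*} [DecidableEq α]

/-- If the sum of `v` over the members of a `d`-uniform family above each set in its shadow vanishes,
then it vanishes above every set with fewer than `d` elements. -/
lemma sum_filter_superset_eq_zero_s5 [Fintype α] {X : Finset (Finset α)} {d : ℕ}
    (hX : ∀ A ∈ X, #A = d) (v : Finset α → ℚ)
    (hv : ∀ S ∈ ∂ X, ∑ A ∈ X with S ⊆ A, v A = 0) (j : ℕ) :
    ∀ S : Finset α, #S + 1 + j = d → ∑ A ∈ X with S ⊆ A, v A = 0 := by
  induction j with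
  | zero =>
    intro S hS
    by_cases h : S ∈ ∂ X
    · exact hv S h
    · refine sum_eq_zero fun A hA => absurd ?_ h
      obtain ⟨hAX, hSA⟩ := mem_filter.1 hA
      rw [mem_shadow_iff_exists_mem_card_add_one]
      exact ⟨A, hAX, hSA, by rw [hX A hAX]; omega⟩
  | succ j ih =>
    intro S hS
    have h1 : ∑ x ∈ Sᶜ, ∑ A ∈ X with insert x S ⊆ A, v A = 0 := by
      refine sum_eq_zero fun x hx => ih _ ?_
      rw [card_insert_of_notMem (mem_compl.1 hx)]
      omega
    have h2 : ∑ x ∈ Sᶜ, ∑ A ∈ X with insert x S ⊆ A, v A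
        = ∑ A ∈ X with S ⊆ A, ((d - #S : ℕ) : ℚ) * v A := by
      rw [sum_comm' (s' := fun A => A \ S) (t' := X.filter fun A => S ⊆ A)]
      · refine sum_congr rfl fun A hA => ?_
        obtain ⟨hAX, hSA⟩ := mem_filter.1 hA
        rw [sum_const, card_sdiff_of_subset hSA, hX A hAX, nsmul_eq_mul]
      · intro x A
        simp only [mem_compl, mem_filter, mem_sdiff, insert_subset_iff]
        tauto
    rw [h1, ← mul_sum] at h2
    refine (mul_eq_zero.1 h2.symm).resolve_left ?_
    have : d - #S ≠ 0 := by omega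
    exact_mod_cast this

/-- Katona: a uniform intersecting family is no larger than its shadow. -/
lemma card_le_card_shadow_of_intersecting_s5 [Fintype α] {X : Finset (Finset α)} {d : ℕ}
    (hX : ∀ A ∈ X, #A = d) (hint : ∀ A ∈ X, ∀ B ∈ X, (A ∩ B).Nonempty) : #X ≤ #(∂ X) := by
  classical
  let L : (X → ℚ) →ₗ[ℚ] (∂ X → ℚ) :=
    { toFun := fun v S => ∑ A : X, if S.1 ⊆ A.1 then v A else 0
      map_add' := fun v w => by
        ext S
        simp only [Pi.add_apply, ← sum_add_distrib]
        exact sum_congr rfl fun A _ => by split_ifs <;> simp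
      map_smul' := fun c v => by
        ext S
        simp [mul_sum] }
  have hL : Function.Injective L := by
    rw [← LinearMap.ker_eq_bot, LinearMap.ker_eq_bot']
    intro w hw
    let v : Finset α → ℚ := fun A => if h : A ∈ X then w ⟨A, h⟩ else 0
    have hvw : ∀ A : X, v A = w A := fun A => by simp [v]
    have hv : ∀ S ∈ ∂ X, ∑ A ∈ X with S ⊆ A, v A = 0 := by
      intro S hS
      have := congrFun hw ⟨S, hS⟩
      rw [sum_filter, ← sum_coe_sort]
      simpa [L, hvw] using this
    have hzero : ∀ S : Finset α, #S < d → ∑ A ∈ X with S ⊆ A, v A = 0 := fun S hS =>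
      sum_filter_superset_eq_zero_s5 hX v hv (d - #S - 1) S (by omega)
    ext ⟨B, hB⟩
    have h1 : ∑ S ∈ B.powerset, ((-1) ^ #S : ℚ) * ∑ A ∈ X with S ⊆ A, v A = 0 := by
      simp only [mul_sum]
      rw [sum_comm' (s' := fun A => (A ∩ B).powerset) (t' := X)]
      · refine sum_eq_zero fun A hA => ?_
        rw [← sum_mul]
        have := sum_powerset_neg_one_pow_card_of_nonempty (hint A hA B hB)
        have h3 : ∑ S ∈ (A ∩ B).powerset, ((-1) ^ #S : ℚ) = 0 := by exact_mod_cast this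
        rw [h3, zero_mul]
      · intro S A
        simp only [mem_powerset, mem_filter, subset_inter_iff]
        tauto
    rw [sum_eq_single B] at h1
    · have h2 : ∑ A ∈ X with B ⊆ A, v A = v B := by
        have : X.filter (fun A => B ⊆ A) = {B} := by
          ext A
          simp only [mem_filter, mem_singleton]
          refine ⟨fun h => (eq_of_subset_of_card_le h.2 ?_).symm, ?_⟩
          · rw [hX A h.1, hX B hB]
          · rintro rfl
            exact ⟨hB, subset_rfl⟩
        rw [this, sum_singleton]
      rw [h2] at h1
      have := (mul_eq_zero.1 h1).resolve_left (pow_ne_zero _ (by norm_num))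
      simpa [v, hB] using this
    · intro S hS hne
      rw [hzero S, mul_zero]
      rw [← hX B hB]
      exact card_lt_card (((mem_powerset.1 hS).ssubset_of_ne hne))
    · intro h
      exact absurd (mem_powerset_self B) h
  have := LinearMap.finrank_le_finrank_of_injective hL
  simpa using this

/-- The dual form of Katona's shadow bound: a uniform family in which no two members cover the ground
set is no larger than its upper shadow. -/
lemma card_le_card_upShadow [Fintype α] {X : Finset (Finset α)} {c : ℕ}
    (hX : ∀ A ∈ X, #A = c) (hunion : ∀ A ∈ X, ∀ B ∈ X, A ∪ B ≠ univ) : #X ≤ #(∂⁺ X) := by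
  have h := card_le_card_shadow_of_intersecting_s5 (X := Xᶜˢ) (d := Fintype.card α - c) ?_ ?_
  · rwa [shadow_compls, card_compls, card_compls] at h
  · intro A hA
    have := hX _ (mem_compls.1 hA)
    rw [card_compl] at this
    have := card_le_univ A
    omega
  · intro A hA B hB
    have := hunion _ (mem_compls.1 hA) _ (mem_compls.1 hB)
    rw [← compl_inter, Ne, compl_eq_univ_iff] at this
    exact nonempty_iff_ne_empty.2 this

end Shadow

section Chains

variable {α : Type*}

/-- `F` contains a chain of `j + 1` sets with largest member `A`. -/
def HasChain (F : Finset (Finset α)) : ℕ → Finset α → Prop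
  | 0, A => A ∈ F
  | j + 1, A => A ∈ F ∧ ∃ B, B ⊂ A ∧ HasChain F j B

lemma HasChain.mem {F : Finset (Finset α)} {j : ℕ} {A : Finset α} (h : HasChain F j A) : A ∈ F := by
  cases j with
  | zero => exact h
  | succ j => exact h.1

lemma HasChain.exists_of_le {F : Finset (Finset α)} {i j : ℕ} (hij : j ≤ i) {A : Finset α}
    (h : HasChain F i A) : ∃ B ⊆ A, HasChain F j B := by
  induction i generalizing A with
  | zero =>
    obtain rfl : j = 0 := by omega
    exact ⟨A, subset_rfl, h⟩
  | succ i ih =>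
    rcases hij.eq_or_lt with rfl | hlt
    · exact ⟨A, subset_rfl, h⟩
    · obtain ⟨B, hBA, hB⟩ := h.2
      obtain ⟨C, hCB, hC⟩ := ih (by omega) hB
      exact ⟨C, hCB.trans hBA.subset, hC⟩

lemma HasChain.le_card {F : Finset (Finset α)} {a : ℕ} (ha : ∀ A ∈ F, a ≤ #A) {j : ℕ}
    {A : Finset α} (h : HasChain F j A) : a + j ≤ #A := by
  induction j generalizing A with
  | zero => exact ha A h
  | succ j ih =>
    obtain ⟨B, hBA, hB⟩ := h.2
    have := ih hB
    have := card_lt_card hBA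
    omega

lemma HasChain.exists_seq {F : Finset (Finset α)} {j : ℕ} {A : Finset α} (h : HasChain F j A) :
    ∃ c : ℕ → Finset α, c j = A ∧ (∀ i ≤ j, c i ∈ F) ∧ ∀ i l, i < l → l ≤ j → c i ⊂ c l := by
  induction j generalizing A with
  | zero => exact ⟨fun _ => A, rfl, fun _ _ => h, fun i l h1 h2 => by omega⟩
  | succ j ih =>
    obtain ⟨hA, B, hBA, hB⟩ := h
    obtain ⟨c, hc, hcF, hcs⟩ := ih hB
    refine ⟨Function.update c (j + 1) A, by simp, fun i hi => ?_, fun i l hil hl => ?_⟩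
    · rcases hi.eq_or_lt with rfl | hlt
      · simpa using hA
      · rw [Function.update_of_ne (by omega)]
        exact hcF i (by omega)
    · rw [Function.update_of_ne (by omega : i ≠ j + 1)]
      rcases hl.eq_or_lt with rfl | hlt
      · rw [Function.update_self]
        refine LE.le.trans_ssubset ?_ hBA
        rw [← hc]
        rcases (Nat.lt_succ_iff.1 hil).eq_or_lt with rfl | hij
        · exact subset_rfl
        · exact (hcs i j hij le_rfl).subset
      · rw [Function.update_of_ne (by omega : l ≠ j + 1)]
        exact hcs i l hil (by omega)

end Chains

section Families

variable {n : ℕ}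

lemma isKSperner_iff {k : ℕ} {F : Finset (Finset (Fin n))} :
    IsKSperner k F ↔ ∀ A, ¬ HasChain F k A := by
  constructor
  · intro h A hA
    obtain ⟨c, -, hcF, hcs⟩ := hA.exists_seq
    exact h ⟨fun i => c i, fun i => hcF i (by omega), fun i j hij => hcs i j hij (by omega)⟩
  · rintro h ⟨c, hcF, hcs⟩
    have key : ∀ i (hi : i < k + 1), HasChain F i (c ⟨i, hi⟩) := by
      intro i
      induction i with
      | zero => exact fun hi => hcF _
      | succ i ih =>
        exact fun hi => ⟨hcF _, _, hcs ⟨i, by omega⟩ _ (Fin.mk_lt_mk.2 (by omega)), ih (by omega)⟩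
    exact h _ (key k (by omega))

lemma IsKSperner.compls {k : ℕ} {F : Finset (Finset (Fin n))} (h : IsKSperner k F) :
    IsKSperner k Fᶜˢ := by
  rintro ⟨c, hcF, hcs⟩
  refine h ⟨fun i => (c i.rev)ᶜ, fun i => mem_compls.1 (hcF _), fun i j hij => ?_⟩
  exact compl_ssubset_compl.2 (hcs _ _ (Fin.rev_lt_rev.2 hij))

/-- The members of `F` reached from its members of size `a` by `i` covering steps inside `F`. -/
def coverLayer (F : Finset (Finset (Fin n))) (a : ℕ) : ℕ → Finset (Finset (Fin n))
  | 0 => F.filter fun A => #A = a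
  | i + 1 => ∂⁺ (coverLayer F a i) ∩ F

lemma coverLayer_subset (F : Finset (Finset (Fin n))) (a i : ℕ) : coverLayer F a i ⊆ F := by
  cases i with
  | zero => exact filter_subset _ _
  | succ i => exact inter_subset_right

lemma card_of_mem_upShadow {X : Finset (Finset (Fin n))} {c : ℕ} (hX : ∀ A ∈ X, #A = c)
    {A : Finset (Fin n)} (hA : A ∈ ∂⁺ X) : #A = c + 1 := by
  obtain ⟨B, hB, -, h⟩ := mem_upShadow_iff_exists_mem_card_add_one.1 hA
  rw [← hX B hB, h]

lemma card_of_mem_coverLayer {F : Finset (Finset (Fin n))} {a i : ℕ} :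
    ∀ A ∈ coverLayer F a i, #A = a + i := by
  induction i with
  | zero => exact fun A hA => (mem_filter.1 hA).2
  | succ i ih => exact fun A hA => card_of_mem_upShadow ih (mem_inter.1 hA).1

lemma exists_ssubset_of_mem_upShadow {X : Finset (Finset (Fin n))} {A : Finset (Fin n)}
    (hA : A ∈ ∂⁺ X) : ∃ B ∈ X, B ⊂ A := by
  obtain ⟨B, hB, hBA, h⟩ := mem_upShadow_iff_exists_mem_card_add_one.1 hA
  exact ⟨B, hB, hBA.ssubset_of_ne fun h' => by rw [h'] at h; omega⟩

lemma hasChain_of_mem_coverLayer {F : Finset (Finset (Fin n))} {a i : ℕ} :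
    ∀ A ∈ coverLayer F a i, HasChain F i A := by
  induction i with
  | zero => exact fun A hA => (mem_filter.1 hA).1
  | succ i ih =>
    intro A hA
    obtain ⟨hA1, hA2⟩ := mem_inter.1 hA
    obtain ⟨B, hB, hBA⟩ := exists_ssubset_of_mem_upShadow hA1
    exact ⟨hA2, B, hBA, ih B hB⟩

/-- The bottom level `a` of a `k`-Sperner family can be removed and replaced by supersets of members
of the family, without decreasing the cardinality. -/
lemma IsKSperner.exists_push_up {k a : ℕ} {F : Finset (Finset (Fin n))} (hsp : IsKSperner k F)
    (ha : ∀ A ∈ F, a ≤ #A)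
    (hunion : ∀ A ∈ F, ∀ B ∈ F, #A = #B → #A < a + k → A ∪ B ≠ univ) :
    ∃ F' : Finset (Finset (Fin n)), IsKSperner k F' ∧ #F ≤ #F' ∧ (∀ A ∈ F', a + 1 ≤ #A) ∧
      (∀ A ∈ F', A ∈ F ∨ #A ≤ a + k ∧ ∃ B ∈ F, B ⊆ A) ∧ ∀ A ∈ F, a < #A → A ∈ F' := by
  set G := coverLayer F a with hG
  set N : ℕ → Finset (Finset (Fin n)) := fun i => ∂⁺ (G i) \ F with hN
  have hGk : G k = ∅ := eq_empty_of_forall_notMem fun A hA =>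
    isKSperner_iff.1 hsp A (hasChain_of_mem_coverLayer A hA)
  have hNcard : ∀ i, ∀ A ∈ N i, #A = a + i + 1 := fun i A hA =>
    card_of_mem_upShadow card_of_mem_coverLayer (mem_sdiff.1 hA).1
  have hstep : ∀ i < k, #(G i) ≤ #(N i) + #(G (i + 1)) := by
    intro i hi
    have h1 : #(G i) ≤ #(∂⁺ (G i)) := by
      refine card_le_card_upShadow card_of_mem_coverLayer fun A hA B hB => ?_
      have hcA := card_of_mem_coverLayer A hA
      have hcB := card_of_mem_coverLayer B hB
      exact hunion A (coverLayer_subset F a i hA) B (coverLayer_subset F a i hB)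
        (by omega) (by omega)
    have h2 : #(∂⁺ (G i) \ F) + #(∂⁺ (G i) ∩ F) = #(∂⁺ (G i)) := card_sdiff_add_card_inter _ _
    exact h1.trans h2.ge
  have hsum : ∀ j ≤ k, #(G 0) ≤ ∑ i ∈ range j, #(N i) + #(G j) := by
    intro j
    induction j with
    | zero => simp
    | succ j ih =>
      intro hj
      have h1 := ih (by omega)
      have h2 := hstep j (by omega)
      rw [sum_range_succ]
      omega
  have hU : #((range k).biUnion N) = ∑ i ∈ range k, #(N i) := by
    refine card_biUnion fun i _ j _ hij => disjoint_left.2 fun A hA hA' => hij ?_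
    have h1 := hNcard i A hA
    have h2 := hNcard j A hA'
    omega
  have hdisj : Disjoint (F \ G 0) ((range k).biUnion N) := by
    refine disjoint_left.2 fun A hA hA' => ?_
    obtain ⟨i, -, hi⟩ := mem_biUnion.1 hA'
    exact (mem_sdiff.1 hi).2 (mem_sdiff.1 hA).1
  have hmem : ∀ A ∈ (F \ G 0) ∪ (range k).biUnion N, (A ∈ F ∧ #A ≠ a) ∨ ∃ i < k, A ∈ N i := by
    intro A hA
    rcases mem_union.1 hA with h | h
    · obtain ⟨h1, h2⟩ := mem_sdiff.1 h
      exact Or.inl ⟨h1, fun h' => h2 (mem_filter.2 ⟨h1, h'⟩)⟩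
    · obtain ⟨i, hi, hA⟩ := mem_biUnion.1 h
      exact Or.inr ⟨i, mem_range.1 hi, hA⟩
  have hlow : ∀ A ∈ (F \ G 0) ∪ (range k).biUnion N, a + 1 ≤ #A := by
    intro A hA
    rcases hmem A hA with ⟨h1, h2⟩ | ⟨i, -, hi⟩
    · have := ha A h1
      omega
    · have := hNcard i A hi
      omega
  refine ⟨(F \ G 0) ∪ (range k).biUnion N, ?_, ?_, hlow, ?_, ?_⟩
  · have key : ∀ j A, HasChain ((F \ G 0) ∪ (range k).biUnion N) j A →
        ∃ B ⊆ A, HasChain F j B := by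
      intro j
      induction j with
      | zero =>
        intro A hA
        rcases hmem A hA with ⟨h1, -⟩ | ⟨i, -, hi⟩
        · exact ⟨A, subset_rfl, h1⟩
        · obtain ⟨B, hB, hBA⟩ := exists_ssubset_of_mem_upShadow (mem_sdiff.1 hi).1
          exact ⟨B, hBA.subset, coverLayer_subset F a i hB⟩
      | succ j ih =>
        intro A hA
        rcases hmem A hA.mem with ⟨h1, -⟩ | ⟨i, -, hi⟩
        · obtain ⟨B, hBA, hB⟩ := hA.2
          obtain ⟨C, hCB, hC⟩ := ih B hB
          exact ⟨A, subset_rfl, h1, C, hCB.trans_ssubset hBA, hC⟩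
        · have h1 := hA.le_card hlow
          have h2 := hNcard i A hi
          obtain ⟨B, hB, hBA⟩ := exists_ssubset_of_mem_upShadow (mem_sdiff.1 hi).1
          obtain ⟨C, hCB, hC⟩ :=
            (hasChain_of_mem_coverLayer B hB).exists_of_le (by omega : j + 1 ≤ i)
          exact ⟨C, hCB.trans hBA.subset, hC⟩
    refine isKSperner_iff.2 fun A hA => ?_
    obtain ⟨B, -, hB⟩ := key k A hA
    exact isKSperner_iff.1 hsp B hB
  · rw [card_union_of_disjoint hdisj, hU]
    have h1 := hsum k le_rfl
    rw [hGk, card_empty] at h1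
    have h2 := card_sdiff_add_card_eq_card (coverLayer_subset F a 0)
    rw [← hG] at h2
    omega
  · intro A hA
    rcases hmem A hA with ⟨h1, -⟩ | ⟨i, hi, hiA⟩
    · exact Or.inl h1
    · obtain ⟨B, hB, hBA⟩ := exists_ssubset_of_mem_upShadow (mem_sdiff.1 hiA).1
      have := hNcard i A hiA
      exact Or.inr ⟨by omega, B, coverLayer_subset F a i hB, hBA.subset⟩
  · intro A hA hlt
    refine mem_union_left _ (mem_sdiff.2 ⟨hA, fun h => ?_⟩)
    have := (mem_filter.1 h).2
    omega

/-- The top level `b` of a `k`-Sperner family can be removed and replaced by smaller sets at most `k`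
levels below, without decreasing the cardinality. -/
lemma IsKSperner.exists_push_down {k b : ℕ} {F : Finset (Finset (Fin n))} (hsp : IsKSperner k F)
    (hb : ∀ A ∈ F, #A ≤ b)
    (hinter : ∀ A ∈ F, ∀ B ∈ F, #A = #B → b < #A + k → (A ∩ B).Nonempty) :
    ∃ F' : Finset (Finset (Fin n)), IsKSperner k F' ∧ #F ≤ #F' ∧ (∀ A ∈ F', #A + 1 ≤ b) ∧
      (∀ A ∈ F', A ∈ F ∨ b ≤ #A + k) ∧ ∀ A ∈ F, #A < b → A ∈ F' := by
  have hle : ∀ A : Finset (Fin n), #A ≤ n := fun A => by simpa using card_le_univ A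
  rcases lt_or_ge n b with hnb | hbn
  · exact ⟨F, hsp, le_rfl, fun A _ => by have := hle A; omega, fun A hA => Or.inl hA,
      fun A hA _ => hA⟩
  have hc : ∀ A : Finset (Fin n), #Aᶜ = n - #A := fun A => by simp [card_compl]
  have hlow : ∀ A ∈ Fᶜˢ, n - b ≤ #A := fun A hA => by
    have := hb _ (mem_compls.1 hA)
    have := hc A
    omega
  have hunion : ∀ A ∈ Fᶜˢ, ∀ B ∈ Fᶜˢ, #A = #B → #A < n - b + k → A ∪ B ≠ univ := by
    intro A hA B hB hAB hlt h
    have h6 := hc A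
    have h7 := hc B
    have h8 := hle A
    have := hinter _ (mem_compls.1 hA) _ (mem_compls.1 hB) (by omega) (by omega)
    rw [← compl_union, h, compl_univ] at this
    exact not_nonempty_empty this
  obtain ⟨F', h1, h2, h3, h4, h5⟩ := hsp.compls.exists_push_up hlow hunion
  refine ⟨F'ᶜˢ, h1.compls, by simpa using h2, fun A hA => ?_, fun A hA => ?_, fun A hA hlt => ?_⟩
  · have := h3 _ (mem_compls.1 hA)
    have := hc A
    omega
  · rcases h4 _ (mem_compls.1 hA) with h | ⟨h, -⟩
    · exact Or.inl (by simpa using h)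
    · have := hc A
      have := hle A
      exact Or.inr (by omega)
  · have := hc A
    exact mem_compls.2 (h5 _ (by simpa using hA) (by omega))

lemma TIntersecting.exists_le_card {t k M : ℕ} (hM : n + t = 2 * M)
    {F : Finset (Finset (Fin n))} (hint : TIntersecting t F) (hsp : IsKSperner k F) (a : ℕ)
    (hak : a + k ≤ M + 1 ∨ a = 0) :
    ∃ F' : Finset (Finset (Fin n)), TIntersecting t F' ∧ IsKSperner k F' ∧ #F ≤ #F' ∧
      ∀ A ∈ F', a ≤ #A := by
  induction a with
  | zero => exact ⟨F, hint, hsp, le_rfl, fun _ _ => Nat.zero_le _⟩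
  | succ a ih =>
    obtain ⟨F₁, hint₁, hsp₁, hcard₁, hlow₁⟩ := ih (by omega)
    obtain ⟨F₂, hsp₂, hcard₂, hlow₂, hsup, -⟩ :=
      hsp₁.exists_push_up hlow₁ (fun A hA B hB hAB hlt h => by
        have h1 := hint₁ A hA B hB
        have h2 := card_union_add_card_inter A B
        rw [h, card_univ, Fintype.card_fin] at h2
        omega)
    have hsub : ∀ A ∈ F₂, ∃ B ∈ F₁, B ⊆ A := fun A hA =>
      (hsup A hA).elim (fun h => ⟨A, h, subset_rfl⟩) fun h => h.2
    refine ⟨F₂, fun A hA B hB => ?_, hsp₂, hcard₁.trans hcard₂, hlow₂⟩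
    obtain ⟨A', hA', hAA⟩ := hsub A hA
    obtain ⟨B', hB', hBB⟩ := hsub B hB
    exact (hint₁ A' hA' B' hB').trans (card_le_card (inter_subset_inter hAA hBB))

lemma add_le_card_add_card_inter (A B : Finset (Fin n)) : #A + #B ≤ n + #(A ∩ B) := by
  have h1 := card_union_add_card_inter A B
  have h2 : #(A ∪ B) ≤ n := by simpa using card_le_univ (A ∪ B)
  omega

lemma TIntersecting.exists_card_le {t k M m : ℕ} (hM : n + t = 2 * M) (hmM : m ≤ M) (j : ℕ) :
    ∀ F : Finset (Finset (Fin n)), TIntersecting t F → IsKSperner k F → (∀ A ∈ F, M - m ≤ #A) →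
      (∀ A ∈ F, #A + 1 ≤ M + k + m + j) →
    ∃ F' : Finset (Finset (Fin n)), TIntersecting t F' ∧ IsKSperner k F' ∧ #F ≤ #F' ∧
      (∀ A ∈ F', M - m ≤ #A) ∧ (∀ A ∈ F', #A + 1 ≤ M + k + m) ∧
      ∀ A ∈ F, #A + 1 ≤ M + k + m → A ∈ F' := by
  induction j with
  | zero => exact fun F hint hsp hlow hup => ⟨F, hint, hsp, le_rfl, hlow, hup, fun A hA _ => hA⟩
  | succ j ih =>
    intro F hint hsp hlow hup
    obtain ⟨F₁, hsp₁, hcard₁, hup₁, hnew, hold⟩ :=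
      hsp.exists_push_down (b := M + k + m + j) (fun A hA => by have := hup A hA; omega)
        (fun A hA B hB hAB hlt => by
          have := add_le_card_add_card_inter A B
          exact card_pos.1 (by omega))
    have hlow₁ : ∀ A ∈ F₁, M - m ≤ #A := fun A hA =>
      (hnew A hA).elim (hlow A) fun h => by omega
    obtain ⟨F₂, hint₂, hsp₂, hcard₂, hlow₂, hup₂, hold₂⟩ := ih F₁ (fun A hA B hB => by
      have h1 := add_le_card_add_card_inter A B
      have h2 := hlow₁ A hA
      have h3 := hlow₁ B hB
      rcases hnew A hA with hA' | hA'
      · rcases hnew B hB with hB' | hB'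
        · exact hint A hA' B hB'
        · omega
      · omega) hsp₁ hlow₁ hup₁
    exact ⟨F₂, hint₂, hsp₂, hcard₁.trans hcard₂, hlow₂, hup₂,
      fun A hA h => hold₂ A (hold A hA (by omega)) h⟩

end Families

/-- If `n + t` is even, every nonempty `t`-intersecting `k`-Sperner
family `F ⊆ 2^[n]` admits a `t`-intersecting `k`-Sperner `F''` with `|F''| ≥ |F|`,
minimum size `(n+t)/2 - m` and maximum size at most `(n+t)/2 + k - 1 + m`
for some `0 ≤ m ≤ k - 1`. -/
theorem stmt_5 (n t k : ℕ) (hn : 0 < n) (ht : 0 < t) (hk : 0 < k)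
    (htn : t ≤ n) (hpar : Even (n + t))
    (F : Finset (Finset (Fin n))) (hne : F.Nonempty)
    (hint : TIntersecting t F) (hsp : IsKSperner k F) :
    ∃ F'' : Finset (Finset (Fin n)), ∃ m : ℕ, m ≤ k - 1 ∧
      TIntersecting t F'' ∧ IsKSperner k F'' ∧ F.card ≤ F''.card ∧
      (∀ A ∈ F'', ((n + t) / 2 : ℤ) - m ≤ A.card) ∧
      (∃ A ∈ F'', (A.card : ℤ) = ((n + t) / 2 : ℤ) - m) ∧
      ∀ A ∈ F'', (A.card : ℤ) ≤ ((n + t) / 2 : ℤ) + k - 1 + m := by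
  obtain ⟨M, hM⟩ := hpar.two_dvd
  have hMZ : ((n + t) / 2 : ℤ) = M := by omega
  rw [hMZ]
  obtain ⟨F₁, hint₁, hsp₁, hcard₁, hlow₁⟩ := hint.exists_le_card hM hsp (M + 1 - k) (by omega)
  have hne₁ : F₁.Nonempty := card_pos.1 (hne.card_pos.trans_le hcard₁)
  have hle : ∀ A : Finset (Fin n), #A ≤ n := fun A => by simpa using card_le_univ A
  obtain ⟨A₀, hA₀, hmin⟩ := exists_min_image F₁ card hne₁
  rcases le_or_gt #A₀ M with hA₀M | hA₀M
  · obtain ⟨F₂, hint₂, hsp₂, hcard₂, hlow₂, hup₂, hold⟩ :=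
      TIntersecting.exists_card_le hM (Nat.sub_le M #A₀) n F₁ hint₁ hsp₁
        (fun A hA => by have := hmin A hA; omega) (fun A _ => by have := hle A; omega)
    have h0 := hlow₁ A₀ hA₀
    refine ⟨F₂, M - #A₀, by omega, hint₂, hsp₂, hcard₁.trans hcard₂, fun A hA => ?_,
      ⟨A₀, hold A₀ hA₀ (by omega), by omega⟩, fun A hA => ?_⟩
    · have := hlow₂ A hA
      omega
    · have := hup₂ A hA
      omega
  · obtain ⟨F₂, hint₂, hsp₂, hcard₂, hlow₂, hup₂, -⟩ :=
      TIntersecting.exists_card_le hM (Nat.zero_le M) n F₁ hint₁ hsp₁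
        (fun A hA => by have := hmin A hA; omega) (fun A _ => by have := hle A; omega)
    obtain ⟨B, -, hB⟩ := exists_subset_card_eq (s := (univ : Finset (Fin n))) (n := M)
      (by rw [card_univ, Fintype.card_fin]; omega)
    have hlow₃ : ∀ A ∈ insert B F₂, M ≤ #A := by
      intro A hA
      rcases mem_insert.1 hA with rfl | hA
      · omega
      · exact hlow₂ A hA
    have hup₃ : ∀ A ∈ insert B F₂, #A + 1 ≤ M + k := by
      intro A hA
      rcases mem_insert.1 hA with rfl | hA
      · omega
      · exact hup₂ A hA
    refine ⟨insert B F₂, 0, by omega, fun A hA C hC => ?_, isKSperner_iff.2 fun A hA => ?_,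
      (hcard₁.trans hcard₂).trans (card_le_card (subset_insert _ _)), fun A hA => ?_,
      ⟨B, mem_insert_self _ _, by omega⟩, fun A hA => ?_⟩
    · have := add_le_card_add_card_inter A C
      have := hlow₃ A hA
      have := hlow₃ C hC
      omega
    · have := hA.le_card hlow₃
      have := hup₃ A hA.mem
      omega
    · have := hlow₃ A hA
      omega
    · have := hup₃ A hA
      omega
end

section
/- Let n, t, k be positive integers with n+t even, let σ be a cyclic permutation of [n], let m be an integer with 0 ≤ m ≤ k−1, and suppose (n+t)/2 + k + m ≤ n. If G is a t-intersecting k-Sperner family of intervals of σ such that every interval in G has size between (n+t)/2 − m and (n+t)/2 + k − 1 + m, then there exists a full consecutive σ-k-Sperner t-intersecting family G' with Σ_{G ∈ G} C(n,|G|) ≤ Σ_{G' ∈ G'} C(n,|G'|). -/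
open Finset

/-- `σ` is a cyclic permutation of `[n]`: its cycle decomposition is a single `n`-cycle. -/
def IsCyclicPerm {n : ℕ} (σ : Equiv.Perm (Fin n)) : Prop :=
  σ.IsCycle ∧ σ.support = Finset.univ

/-- `F` is an interval of `σ`: `F = {x, σ x, …, σ^(ℓ-1) x}` for some `x`,
where `ℓ = |F|` satisfies `1 ≤ ℓ ≤ n - 1`. -/
def IsIntervalOf {n : ℕ} (σ : Equiv.Perm (Fin n)) (F : Finset (Fin n)) : Prop :=
  1 ≤ F.card ∧ F.card ≤ n - 1 ∧
    ∃ x : Fin n, F = (Finset.range F.card).image (fun i => (σ ^ i) x)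

/-- The chain `C_h`: the intervals of lengths `1, …, n-1` starting at `σ h`. -/
def chainAt {n : ℕ} (σ : Equiv.Perm (Fin n)) (h : Fin n) : Finset (Finset (Fin n)) :=
  (Finset.Icc 1 (n - 1)).image (fun ℓ => (Finset.range ℓ).image (fun i => (σ ^ i) (σ h)))

/-- `G` is a `σ`-`k`-Sperner `t`-intersecting family: a `t`-intersecting family of
intervals of `σ` meeting every chain `C_h` in at most `k` sets. -/
def SigmaKSpernerTIntersecting {n : ℕ} (σ : Equiv.Perm (Fin n)) (k t : ℕ)
    (G : Finset (Finset (Fin n))) : Prop :=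
  (∀ A ∈ G, IsIntervalOf σ A) ∧ TIntersecting t G ∧
    ∀ h : Fin n, (G ∩ chainAt σ h).card ≤ k

/-- `G` is consecutive: in every chain `C_h` the lengths of the members of `G ∩ C_h`
form a set of consecutive integers. -/
def ConsecutiveFam {n : ℕ} (σ : Equiv.Perm (Fin n)) (G : Finset (Finset (Fin n))) : Prop :=
  ∀ h : Fin n, ∃ a : ℕ,
    (G ∩ chainAt σ h).image Finset.card = Finset.Ico a (a + (G ∩ chainAt σ h).card)

/-- `G` is full consecutive: consecutive and meeting every chain `C_h` in exactly `k` sets. -/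
def FullConsecutive {n : ℕ} (σ : Equiv.Perm (Fin n)) (k : ℕ)
    (G : Finset (Finset (Fin n))) : Prop :=
  ConsecutiveFam σ G ∧ ∀ h : Fin n, (G ∩ chainAt σ h).card = k

/-- The arc of length `ℓ` of `σ` that starts at `σ h`. -/
def arc {n : ℕ} (σ : Equiv.Perm (Fin n)) (h : Fin n) (ℓ : ℕ) : Finset (Fin n) :=
  (Finset.range ℓ).image (fun i => (σ ^ i) (σ h))

theorem Nat.choose_le_choose_of_le_of_le_sub {n e r : ℕ} (her : e ≤ r) (hr : r ≤ n - e) :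
    n.choose e ≤ n.choose r := by
  have key : ∀ r, e ≤ r → r ≤ n / 2 → n.choose e ≤ n.choose r := by
    intro r her
    induction r, her using Nat.le_induction with
    | base => intro _; exact le_rfl
    | succ r _ ih =>
      intro hr
      exact (ih (by omega)).trans (Nat.choose_le_succ_of_lt_half_left (by omega))
  rcases le_or_gt r (n / 2) with h | h
  · exact key r her h
  · rw [← Nat.choose_symm (show r ≤ n by omega)]
    exact key _ (by omega) (by omega)

theorem Finset.sum_le_sum_of_card_le_of_sdiff {α : Type*} [DecidableEq α] {L S : Finset α}
    {f : α → ℕ} (hcard : L.card ≤ S.card) (hf : ∀ e ∈ L \ S, ∀ r ∈ S \ L, f e ≤ f r) :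
    ∑ x ∈ L, f x ≤ ∑ x ∈ S, f x := by
  rw [← Finset.sum_sdiff_le_sum_sdiff]
  calc ∑ x ∈ L \ S, f x ≤ (L \ S).card • (L \ S).sup f :=
        Finset.sum_le_card_nsmul _ _ _ fun x hx => Finset.le_sup hx
    _ ≤ (S \ L).card • (L \ S).sup f := by
        have : (L \ S).card ≤ (S \ L).card := by
          have h1 := Finset.card_sdiff_add_card_inter L S
          have h2 := Finset.card_sdiff_add_card_inter S L
          rw [Finset.inter_comm] at h2
          omega
        exact Nat.mul_le_mul_right _ this
    _ ≤ ∑ x ∈ S \ L, f x :=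
        Finset.card_nsmul_le_sum _ _ _ fun r hr => Finset.sup_le fun e he => hf e he r hr

/-- Among the sets of at most `k` lengths that are at least `a`, a window of `k` consecutive
lengths, placed as centrally as `a` permits, has the largest binomial weight. -/
theorem sum_choose_le_sum_choose_window {n k a : ℕ} {L : Finset ℕ} (hL : L.card ≤ k)
    (ha : ∀ ℓ ∈ L, a ≤ ℓ ∧ ℓ ≤ n) :
    ∑ ℓ ∈ L, n.choose ℓ ≤
      ∑ ℓ ∈ Finset.Ico (max a ((n - k + 1) / 2)) (max a ((n - k + 1) / 2) + k), n.choose ℓ := by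
  refine Finset.sum_le_sum_of_card_le_of_sdiff (by simpa using hL) fun e he r hr => ?_
  simp only [Finset.mem_sdiff, Finset.mem_Ico] at he hr
  obtain ⟨h1, h2⟩ := ha e he.1
  rcases lt_or_ge e (max a ((n - k + 1) / 2)) with h | h
  · exact Nat.choose_le_choose_of_le_of_le_sub (by omega) (by omega)
  · rw [← Nat.choose_symm h2]
    exact Nat.choose_le_choose_of_le_of_le_sub (by omega) (by omega)

section Arc

variable {n : ℕ} {σ : Equiv.Perm (Fin n)}

theorem IsCyclicPerm.pow_apply_inj (hσ : IsCyclicPerm σ) {x : Fin n} {i j : ℕ} (hi : i < n)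
    (hj : j < n) (hij : (σ ^ i) x = (σ ^ j) x) : i = j := by
  have hx : σ x ≠ x := by
    rw [← Equiv.Perm.mem_support, hσ.2]; exact Finset.mem_univ x
  have hord : orderOf σ = n := by rw [hσ.1.orderOf, hσ.2]; simp
  exact pow_injOn_Iio_orderOf (by simpa [hord] using hi) (by simpa [hord] using hj)
    (hσ.1.pow_eq_pow_iff.2 ⟨x, hx, hij⟩)

theorem IsCyclicPerm.card_arc (hσ : IsCyclicPerm σ) (h : Fin n) {ℓ : ℕ} (hℓ : ℓ ≤ n) :
    (arc σ h ℓ).card = ℓ := by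
  rw [arc, Finset.card_image_of_injOn, Finset.card_range]
  intro i hi j hj hij
  simp only [Finset.coe_range, Set.mem_Iio] at hi hj
  exact hσ.pow_apply_inj (by omega) (by omega) hij

theorem arc_mono (h : Fin n) : Monotone (arc σ h) := fun _ _ hab =>
  Finset.image_subset_image (Finset.range_mono hab)

theorem IsCyclicPerm.notMem_arc (hσ : IsCyclicPerm σ) (h : Fin n) {ℓ : ℕ} (hℓ : ℓ < n) :
    h ∉ arc σ h ℓ := by
  intro hmem
  obtain ⟨i, hi, hi'⟩ := Finset.mem_image.1 hmem
  rw [Finset.mem_range] at hi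
  have h0 : (σ ^ (i + 1)) h = (σ ^ 0) h := by
    rw [pow_succ, Equiv.Perm.mul_apply, hi', pow_zero, Equiv.Perm.one_apply]
  have := hσ.pow_apply_inj (by omega) (by omega) h0
  omega

/-- An arc determines its starting point. -/
theorem IsCyclicPerm.arc_start_inj (hσ : IsCyclicPerm σ) {h h' : Fin n} {ℓ ℓ' : ℕ}
    (hℓ' : 1 ≤ ℓ') (hℓ'n : ℓ' < n) (heq : arc σ h ℓ = arc σ h' ℓ') : h = h' := by
  have h1 : σ h' ∈ arc σ h' ℓ' := Finset.mem_image.2 ⟨0, Finset.mem_range.2 hℓ', by simp⟩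
  have h2 := hσ.notMem_arc h' hℓ'n
  rw [← heq] at h1 h2
  obtain ⟨i, hi, hi'⟩ := Finset.mem_image.1 h1
  rw [Finset.mem_range] at hi
  cases i with
  | zero => simpa using hi'
  | succ i =>
    refine absurd (Finset.mem_image.2 ⟨i, Finset.mem_range.2 (by omega), ?_⟩) h2
    rw [pow_succ', Equiv.Perm.mul_apply] at hi'
    exact σ.injective hi'

theorem IsIntervalOf.exists_eq_arc {A : Finset (Fin n)} (hA : IsIntervalOf σ A) :
    ∃ h, A = arc σ h A.card := by
  obtain ⟨_, _, x, hx⟩ := hA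
  exact ⟨σ.symm x, by simpa [arc] using hx⟩

/-- The lengths of the members of `G` in the chain `C_h`. -/
def chainLengths (σ : Equiv.Perm (Fin n)) (G : Finset (Finset (Fin n))) (h : Fin n) :
    Finset ℕ :=
  (Finset.Icc 1 (n - 1)).filter (fun ℓ => arc σ h ℓ ∈ G)

theorem IsCyclicPerm.card_chainLengths_le (hσ : IsCyclicPerm σ) {G : Finset (Finset (Fin n))}
    {k : ℕ} (hG : IsKSperner k G) (h : Fin n) : (chainLengths σ G h).card ≤ k := by
  by_contra! hlt
  let e := (chainLengths σ G h).orderEmbOfCardLe hlt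
  have he : ∀ i, e i ∈ chainLengths σ G h := fun i => Finset.orderEmbOfCardLe_mem _ hlt i
  simp only [chainLengths, Finset.mem_filter, Finset.mem_Icc] at he
  refine hG ⟨fun i => arc σ h (e i), fun i => (he i).2, fun i j hij => ?_⟩
  have hlt' : e i < e j := e.strictMono hij
  refine Finset.ssubset_iff_subset_ne.2 ⟨arc_mono h hlt'.le, fun heq => ?_⟩
  have := congrArg Finset.card heq
  rw [hσ.card_arc h (by have := he i; omega), hσ.card_arc h (by have := he j; omega)] at this
  omega

theorem IsCyclicPerm.injOn_arc (hσ : IsCyclicPerm σ) (h : Fin n) :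
    Set.InjOn (arc σ h) (Set.Iic n) := by
  intro i hi j hj hij
  rw [← hσ.card_arc h hi, hij, hσ.card_arc h hj]

/-- The family of the arcs starting at `σ h` with length in `S h`, for all `h`. -/
def arcFamily (σ : Equiv.Perm (Fin n)) (S : Fin n → Finset ℕ) : Finset (Finset (Fin n)) :=
  Finset.univ.biUnion fun h => (S h).image (arc σ h)

theorem IsCyclicPerm.sum_choose_card_arcFamily (hσ : IsCyclicPerm σ) {S : Fin n → Finset ℕ}
    (hS : ∀ h, ∀ ℓ ∈ S h, 1 ≤ ℓ ∧ ℓ < n) :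
    ∑ A ∈ arcFamily σ S, n.choose A.card = ∑ h, ∑ ℓ ∈ S h, n.choose ℓ := by
  rw [arcFamily, Finset.sum_biUnion]
  · refine Finset.sum_congr rfl fun h _ => ?_
    rw [Finset.sum_image ((hσ.injOn_arc h).mono fun ℓ hℓ => (hS h ℓ hℓ).2.le)]
    exact Finset.sum_congr rfl fun ℓ hℓ => by rw [hσ.card_arc h (hS h ℓ hℓ).2.le]
  · intro h _ h' _ hne
    refine Finset.disjoint_left.2 fun A hA hA' => hne ?_
    obtain ⟨ℓ, _, rfl⟩ := Finset.mem_image.1 hA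
    obtain ⟨ℓ', hℓ', heq⟩ := Finset.mem_image.1 hA'
    exact hσ.arc_start_inj (hS h' ℓ' hℓ').1 (hS h' ℓ' hℓ').2 heq.symm

theorem subset_arcFamily_chainLengths {G : Finset (Finset (Fin n))}
    (hG : ∀ A ∈ G, IsIntervalOf σ A) : G ⊆ arcFamily σ (chainLengths σ G) := by
  intro A hA
  obtain ⟨h, hh⟩ := (hG A hA).exists_eq_arc
  refine Finset.mem_biUnion.2 ⟨h, Finset.mem_univ h, Finset.mem_image.2 ⟨A.card, ?_, hh.symm⟩⟩
  exact Finset.mem_filter.2 ⟨Finset.mem_Icc.2 ⟨(hG A hA).1, (hG A hA).2.1⟩, hh ▸ hA⟩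

/-- The family of arcs whose lengths form, at each `h`, the window `c h, …, c h + k - 1`. -/
def windowFamily (σ : Equiv.Perm (Fin n)) (k : ℕ) (c : Fin n → ℕ) : Finset (Finset (Fin n)) :=
  arcFamily σ fun h => Finset.Ico (c h) (c h + k)

theorem mem_windowFamily {k : ℕ} {c : Fin n → ℕ} {A : Finset (Fin n)} :
    A ∈ windowFamily σ k c ↔ ∃ h ℓ, (c h ≤ ℓ ∧ ℓ < c h + k) ∧ arc σ h ℓ = A := by
  simp [windowFamily, arcFamily]

variable {k : ℕ} {c : Fin n → ℕ}

theorem IsCyclicPerm.windowFamily_inter_chainAt (hσ : IsCyclicPerm σ) (hc : ∀ h, 1 ≤ c h)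
    (hcn : ∀ h, c h + k ≤ n) (h : Fin n) :
    windowFamily σ k c ∩ chainAt σ h = (Finset.Ico (c h) (c h + k)).image (arc σ h) := by
  ext A
  simp only [Finset.mem_inter, mem_windowFamily, chainAt, Finset.mem_image, Finset.mem_Icc,
    Finset.mem_Ico]
  constructor
  · rintro ⟨⟨h', ℓ, hℓ, rfl⟩, ℓ', hℓ', heq⟩
    have : h = h' := hσ.arc_start_inj (ℓ := ℓ') (ℓ' := ℓ) (by have := hc h'; omega)
      (by have := hcn h'; omega) heq
    subst this
    exact ⟨ℓ, hℓ, rfl⟩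
  · rintro ⟨ℓ, hℓ, rfl⟩
    exact ⟨⟨h, ℓ, hℓ, rfl⟩, ℓ, by have := hc h; have := hcn h; omega, rfl⟩

theorem IsCyclicPerm.card_windowFamily_inter_chainAt (hσ : IsCyclicPerm σ) (hc : ∀ h, 1 ≤ c h)
    (hcn : ∀ h, c h + k ≤ n) (h : Fin n) : (windowFamily σ k c ∩ chainAt σ h).card = k := by
  rw [hσ.windowFamily_inter_chainAt hc hcn,
    Finset.card_image_of_injOn ((hσ.injOn_arc h).mono fun ℓ hℓ =>
      (Finset.mem_Ico.1 hℓ).2.le.trans (hcn h))]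
  simp

theorem IsCyclicPerm.fullConsecutive_windowFamily (hσ : IsCyclicPerm σ) (hc : ∀ h, 1 ≤ c h)
    (hcn : ∀ h, c h + k ≤ n) : FullConsecutive σ k (windowFamily σ k c) := by
  refine ⟨fun h => ⟨c h, ?_⟩, hσ.card_windowFamily_inter_chainAt hc hcn⟩
  rw [hσ.card_windowFamily_inter_chainAt hc hcn, hσ.windowFamily_inter_chainAt hc hcn,
    Finset.image_image]
  refine (Finset.image_congr fun ℓ hℓ => ?_).trans Finset.image_id
  simp only [Finset.coe_Ico, Set.mem_Ico] at hℓ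
  exact hσ.card_arc h (by have := hcn h; omega)

theorem IsCyclicPerm.isIntervalOf_of_mem_windowFamily (hσ : IsCyclicPerm σ)
    (hc : ∀ h, 1 ≤ c h) (hcn : ∀ h, c h + k ≤ n) {A : Finset (Fin n)}
    (hA : A ∈ windowFamily σ k c) : IsIntervalOf σ A := by
  obtain ⟨h, ℓ, hℓ, rfl⟩ := mem_windowFamily.1 hA
  have h1 := hc h
  have h2 := hcn h
  have hcard := hσ.card_arc h (show ℓ ≤ n by omega)
  refine ⟨by omega, by omega, σ h, ?_⟩
  rw [hcard]
  rfl

end Arc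

/-- If `n + t` is even, `(n+t)/2 + k + m ≤ n`, `0 ≤ m ≤ k-1`, and `G` is a
`t`-intersecting `k`-Sperner family of intervals of `σ` with sizes between `(n+t)/2 - m`
and `(n+t)/2 + k - 1 + m`, then there is a full consecutive `σ`-`k`-Sperner
`t`-intersecting family `G'` with `∑_{G} C(n,|G|) ≤ ∑_{G'} C(n,|G'|)`. -/
theorem stmt_7 (n t k : ℕ) (hn : 0 < n) (ht : 0 < t) (hk : 0 < k)
    (hpar : Even (n + t)) (σ : Equiv.Perm (Fin n)) (hσ : IsCyclicPerm σ)
    (m : ℕ) (hm : m ≤ k - 1) (hrange : (n + t) / 2 + k + m ≤ n)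
    (G : Finset (Finset (Fin n))) (hGint : ∀ A ∈ G, IsIntervalOf σ A)
    (hG : TIntersecting t G) (hGsp : IsKSperner k G)
    (hsize : ∀ A ∈ G, (n + t) / 2 - m ≤ A.card ∧ A.card ≤ (n + t) / 2 + k - 1 + m) :
    ∃ G' : Finset (Finset (Fin n)), SigmaKSpernerTIntersecting σ k t G' ∧
      FullConsecutive σ k G' ∧
      ∑ A ∈ G, n.choose A.card ≤ ∑ A ∈ G', n.choose A.card := by
  have hsum : 2 * ((n + t) / 2) = n + t := Nat.two_mul_div_two_of_even hpar
  set s := (n + t) / 2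
  let M : Fin n → Finset ℕ := fun h => insert (s + m) (chainLengths σ G h)
  let a : Fin n → ℕ := fun h => (M h).min' (Finset.insert_nonempty _ _)
  let c : Fin n → ℕ := fun h => max (a h) ((n - k + 1) / 2)
  have hlen : ∀ h, ∀ ℓ ∈ chainLengths σ G h, ℓ ≤ n ∧ s - m ≤ ℓ ∧ arc σ h ℓ ∈ G := by
    intro h ℓ hℓ
    obtain ⟨h1, h2⟩ := Finset.mem_filter.1 hℓ
    rw [Finset.mem_Icc] at h1
    have h3 := hsize _ h2
    rw [hσ.card_arc h (by omega)] at h3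
    exact ⟨by omega, h3.1, h2⟩
  have ha_mem : ∀ h, a h = s + m ∨ a h ∈ chainLengths σ G h := fun h =>
    Finset.mem_insert.1 (Finset.min'_mem (M h) _)
  have ha_le : ∀ h, a h ≤ s + m := fun h => Finset.min'_le _ _ (Finset.mem_insert_self _ _)
  have ha_ge : ∀ h, s - m ≤ a h := by
    intro h
    rcases ha_mem h with h1 | h1
    · omega
    · exact (hlen h _ h1).2.1
  have hc : ∀ h, 1 ≤ c h := fun h => le_max_of_le_left (by have := ha_ge h; omega)
  have hcn : ∀ h, c h + k ≤ n := by
    intro h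
    have : c h ≤ s + m := max_le (ha_le h) (by omega)
    omega
  have hmem : ∀ A ∈ windowFamily σ k c,
      s - m ≤ A.card ∧ (s + m ≤ A.card ∨ ∃ B ∈ G, B ⊆ A) := by
    intro A hA
    obtain ⟨h, ℓ, ⟨hℓ, hℓ'⟩, rfl⟩ := mem_windowFamily.1 hA
    have h1 : a h ≤ ℓ := (le_max_left _ _).trans hℓ
    have h2 := ha_ge h
    rw [hσ.card_arc h (by have := hcn h; omega)]
    refine ⟨by omega, ?_⟩
    rcases ha_mem h with h3 | h3
    · exact Or.inl (by omega)
    · exact Or.inr ⟨_, (hlen h _ h3).2.2, arc_mono h h1⟩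
  refine ⟨windowFamily σ k c,
    ⟨fun A hA => hσ.isIntervalOf_of_mem_windowFamily hc hcn hA, ?_,
      fun h => (hσ.card_windowFamily_inter_chainAt hc hcn h).le⟩,
    hσ.fullConsecutive_windowFamily hc hcn, ?_⟩
  · intro A hA B hB
    obtain ⟨hA1, hA2⟩ := hmem A hA
    obtain ⟨hB1, hB2⟩ := hmem B hB
    have hunion := Finset.card_union_add_card_inter A B
    have hle : (A ∪ B).card ≤ n := by simpa using Finset.card_le_univ (A ∪ B)
    rcases hA2 with hA2 | ⟨A', hA', hAA⟩
    · omega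
    rcases hB2 with hB2 | ⟨B', hB', hBB⟩
    · omega
    exact (hG A' hA' B' hB').trans
      (Finset.card_le_card (Finset.inter_subset_inter hAA hBB))
  · refine (Finset.sum_le_sum_of_subset (subset_arcFamily_chainLengths hGint)).trans ?_
    rw [windowFamily, hσ.sum_choose_card_arcFamily, hσ.sum_choose_card_arcFamily]
    · refine Finset.sum_le_sum fun h _ => ?_
      exact sum_choose_le_sum_choose_window (hσ.card_chainLengths_le hGsp h) fun ℓ hℓ =>
        ⟨Finset.min'_le _ _ (Finset.mem_insert_of_mem hℓ), (hlen h ℓ hℓ).1⟩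
    · intro h ℓ hℓ
      have := Finset.mem_Ico.1 hℓ
      exact ⟨(hc h).trans this.1, this.2.trans_le (hcn h)⟩
    · intro h ℓ hℓ
      have := Finset.mem_Icc.1 (Finset.mem_filter.1 hℓ).1
      omega
end

section
/- Let n ≥ 3 and let i be an integer with 2 ≤ i ≤ n−1. Let G be a family of intervals of Z/nZ each of size i, and let Δ(G) be the family of all intervals of size i−1 contained in some member of G. Then |Δ(G)| ≥ |G|. -/
open Finset

open scoped Classical

/-- `S` is an interval of the cycle `ℤ/nℤ`: a set of the form `{a, a+1, …, a+ℓ-1}`. -/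
def IsIntervalZMod (n : ℕ) (S : Finset (ZMod n)) : Prop :=
  ∃ a : ZMod n, S = (Finset.range S.card).image (fun j => a + (j : ZMod n))

/-- The offsets of an interval of the cycle can be indexed by natural numbers. -/
lemma isIntervalZMod_iff {n : ℕ} {S : Finset (ZMod n)} :
    IsIntervalZMod n S ↔
      ∃ a : ZMod n, S = (range S.card).image (fun j : ℕ => a + (j : ZMod n)) := by
  have h (a : ZMod n) (l : ℕ) :
      (range l).image (fun j => a + (j : ZMod n)) =
        (range l).image (fun j : ℕ => a + (j : ZMod n)) := by
    ext x
    simp [Finset.bind_def, Finset.pure_def, eq_neg_add_iff_add_eq]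
  exact exists_congr fun a => by rw [h]

/-- An interval of size at most `n` on the cycle has as many elements as its size. -/
lemma card_image_range_add_natCast {n l : ℕ} (hl : l ≤ n) (a : ZMod n) :
    ((range l).image (fun j : ℕ => a + (j : ZMod n))).card = l := by
  rw [card_image_of_injOn, card_range]
  intro x hx y hy h
  have hx' : x < l := by simpa using hx
  have hy' : y < l := by simpa using hy
  exact Nat.ModEq.eq_of_lt_of_lt ((ZMod.natCast_eq_natCast_iff x y n).1 (add_left_cancel h))
    (hx'.trans_le hl) (hy'.trans_le hl)

/-- The starting point of a nonempty proper interval of the cycle is unique. -/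
lemma eq_of_image_range_add_natCast_eq {n l : ℕ} (hl : 0 < l) (hln : l < n) {a b : ZMod n}
    (h : (range l).image (fun j : ℕ => a + (j : ZMod n)) =
      (range l).image (fun j : ℕ => b + (j : ZMod n))) : a = b := by
  have hb : b ∈ (range l).image (fun j : ℕ => a + (j : ZMod n)) := by
    rw [h]
    exact mem_image.2 ⟨0, mem_range.2 hl, by simp⟩
  obtain ⟨j, hj, hjb⟩ := mem_image.1 hb
  rcases j with _ | j
  · simpa using hjb
  · have hpred : a + (j : ZMod n) ∈ (range l).image (fun j : ℕ => b + (j : ZMod n)) := by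
      rw [← h]
      exact mem_image.2 ⟨j, mem_range.2 ((Nat.lt_succ_self j).trans (mem_range.1 hj)), rfl⟩
    obtain ⟨k, hk, hkb⟩ := mem_image.1 hpred
    have hzero : ((k + 1 : ℕ) : ZMod n) = 0 := by
      push_cast at hjb ⊢
      linear_combination hkb + hjb
    have hdvd := (ZMod.natCast_eq_zero_iff _ _).1 hzero
    have hle := Nat.le_of_dvd k.succ_pos hdvd
    have hkl := mem_range.1 hk
    omega

/-- If `G` is a family of intervals of `ℤ/nℤ` of size `i` (`2 ≤ i ≤ n-1`,
`n ≥ 3`), then the family of intervals of size `i - 1` contained in some member of `G`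
is at least as large as `G`. -/
theorem stmt_9 (n : ℕ) (hn : 3 ≤ n) (i : ℕ) (hi1 : 2 ≤ i) (hi2 : i ≤ n - 1)
    (G : Finset (Finset (ZMod n))) (hG : ∀ S ∈ G, S.card = i ∧ IsIntervalZMod n S) :
    G.card ≤ (G.biUnion (fun S => S.powerset.filter
      (fun B => B.card = i - 1 ∧ IsIntervalZMod n B))).card := by
  choose! start hstart using fun S hS => isIntervalZMod_iff.1 (hG S hS).2
  have hG' : ∀ S ∈ G, S = (range i).image (fun j : ℕ => start S + (j : ZMod n)) := by
    intro S hS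
    have h := hstart S hS
    rwa [(hG S hS).1] at h
  refine card_le_card_of_injOn
    (fun S => (range (i - 1)).image (fun j : ℕ => start S + (j : ZMod n))) ?_ ?_
  · intro S hS
    have hcard := card_image_range_add_natCast (show i - 1 ≤ n by omega) (start S)
    refine mem_biUnion.2 ⟨S, hS, mem_filter.2 ⟨mem_powerset.2 ?_, hcard,
      isIntervalZMod_iff.2 ⟨start S, ?_⟩⟩⟩
    · conv_rhs => rw [hG' S hS]
      exact image_subset_image (range_subset_range.2 (Nat.sub_le i 1))
    · rw [hcard]
  · intro S hS T hT h
    have hST : start S = start T :=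
      eq_of_image_range_add_natCast_eq (by omega) (by omega) h
    rw [hG' S hS, hG' T hT, hST]
end

section
/- Let a and b be fixed integers with a < b and 0 < b. Then there exists n0 = n0(a,b) such that for every n ≥ n0, C(n, ⌊n/2⌋ + a) + C(n, ⌊n/2⌋ + b) ≤ C(n, ⌊n/2⌋ + a + 1) + C(n, ⌊n/2⌋ + b − 1). -/
open Finset

/-- `C(n, r)` for an integer `r`, with value `0` when `r < 0`. -/
def chooseZ (n : ℕ) (r : ℤ) : ℕ :=
  if 0 ≤ r then n.choose r.toNat else 0

/-- Local concavity of the binomial coefficients near the middle, with `n = k + q`. -/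
lemma choose_add_choose_le_two_mul {k q : ℕ} (hq : 0 < q)
    (h : ((k : ℤ) + 2 - q) ^ 2 ≤ k + q + 2) :
    (k + q).choose k + (k + q).choose (k + 2) ≤ 2 * (k + q).choose (k + 1) := by
  have h₁ := Nat.choose_succ_right_eq (k + q) k
  have h₂ := Nat.choose_succ_right_eq (k + q) (k + 1)
  rw [show k + q - k = q by omega] at h₁
  rw [show k + q - (k + 1) = q - 1 by omega, show k + 1 + 1 = k + 2 by omega] at h₂
  generalize (k + q).choose k = x at *
  generalize (k + q).choose (k + 1) = y at *
  generalize (k + q).choose (k + 2) = z at *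
  obtain ⟨s, rfl⟩ : ∃ s, q = s + 1 := ⟨q - 1, by omega⟩
  rw [Nat.add_sub_cancel] at h₂
  zify at *
  have hpos : (0 : ℤ) < (k + 2) * (s + 1) := by positivity
  refine le_of_mul_le_mul_left ?_ hpos
  have hy : (0 : ℤ) ≤ y := by positivity
  have hmul := mul_le_mul_of_nonneg_left h hy
  linear_combination hmul - (k + 2 : ℤ) * h₁ + (s + 1 : ℤ) * h₂

/-- The forward differences of `r ↦ C(n, ⌊n/2⌋ + r)` decrease on `[i, j]` for `n` large. -/
lemma choose_half_add_le {i j n : ℕ} (hij : i ≤ j) (hn : (2 * j + 2) ^ 2 ≤ n) :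
    n.choose (n / 2 + i) + n.choose (n / 2 + j + 1) ≤
      n.choose (n / 2 + i + 1) + n.choose (n / 2 + j) := by
  induction j, hij using Nat.le_induction with
  | base => exact (add_comm _ _).le
  | succ j hij ih =>
    have ih := ih (le_trans (by gcongr; omega) hn)
    have hjn : 4 * j + 4 < n := by nlinarith
    obtain ⟨q, hq⟩ : ∃ q, n = n / 2 + j + q := ⟨n - (n / 2 + j), by omega⟩
    have hc := choose_add_choose_le_two_mul (k := n / 2 + j) (q := q) (by omega) (by
      rw [← Nat.cast_add, ← hq]
      have h₁ : (0 : ℤ) ≤ ((n / 2 + j : ℕ) : ℤ) + 2 - q := by omega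
      have h₂ : ((n / 2 + j : ℕ) : ℤ) + 2 - q ≤ 2 * (j + 1) + 2 := by omega
      have h₃ := pow_le_pow_left₀ h₁ h₂ 2
      zify at hn
      linarith)
    rw [← hq] at hc
    rw [show n / 2 + (j + 1) + 1 = n / 2 + j + 2 by omega, ← add_assoc (n / 2) j 1]
    omega

lemma chooseZ_natCast (n k : ℕ) : chooseZ n k = n.choose k := by
  simp [chooseZ]

lemma chooseZ_le_add_one {n : ℕ} {r : ℤ} (h : r < (n / 2 : ℕ)) :
    chooseZ n r ≤ chooseZ n (r + 1) := by
  by_cases hr : 0 ≤ r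
  · lift r to ℕ using hr
    rw [← Nat.cast_succ, chooseZ_natCast, chooseZ_natCast]
    exact Nat.choose_le_succ_of_lt_half_left (by exact_mod_cast h)
  · simp [chooseZ, hr]

/-- For fixed integers `a < b` with `0 < b` there is `n₀` such that for
all `n ≥ n₀`, `C(n, ⌊n/2⌋ + a) + C(n, ⌊n/2⌋ + b) ≤ C(n, ⌊n/2⌋ + a + 1) + C(n, ⌊n/2⌋ + b - 1)`. -/
theorem stmt_10 (a b : ℤ) (hab : a < b) (hb : 0 < b) :
    ∃ n₀ : ℕ, ∀ n : ℕ, n₀ ≤ n →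
      chooseZ n ((n / 2 : ℕ) + a) + chooseZ n ((n / 2 : ℕ) + b) ≤
        chooseZ n ((n / 2 : ℕ) + a + 1) + chooseZ n ((n / 2 : ℕ) + b - 1) := by
  obtain ⟨j, rfl⟩ : ∃ j : ℕ, b = j + 1 := ⟨(b - 1).toNat, by omega⟩
  refine ⟨(2 * j + 2) ^ 2, fun n hn => ?_⟩
  rw [show ((n / 2 : ℕ) : ℤ) + (j + 1) = ((n / 2 + j + 1 : ℕ) : ℤ) by push_cast; ring,
    show ((n / 2 + j + 1 : ℕ) : ℤ) - 1 = ((n / 2 + j : ℕ) : ℤ) by push_cast; ring,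
    chooseZ_natCast, chooseZ_natCast]
  by_cases ha : 0 ≤ a
  · lift a to ℕ using ha
    rw [← Nat.cast_add, ← Nat.cast_succ, chooseZ_natCast, chooseZ_natCast]
    exact choose_half_add_le (by omega) hn
  · have h₁ : chooseZ n ((n / 2 : ℕ) + a) ≤ chooseZ n ((n / 2 : ℕ) + a + 1) :=
      chooseZ_le_add_one (by omega)
    have h₂ := choose_half_add_le (Nat.zero_le j) hn
    have h₃ := Nat.choose_le_middle (n / 2 + 0 + 1) n
    rw [add_zero] at h₂ h₃
    omega
end

section
/- Let t and k be positive integers. There exists n0 = n0(t,k) such that for all n ≥ n0 with n+t even the following holds: let σ be a cyclic permutation of [n], let m be an integer with 0 ≤ m < k, and let G be a full consecutive σ-k-Sperner t-intersecting family of intervals of σ with min{|G| : G ∈ G} = (n+t)/2 − m and max{|G| : G ∈ G} ≤ (n+t)/2 + k − 1 + m; let g_i be the number of intervals of G of length (n+t)/2 + i. Then g_{−j−1} + g_j ≤ n for every integer j with 0 ≤ j ≤ m−1 and j < k−m. -/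
open Finset

theorem IsCyclicPerm.exists_pow_apply_eq {n : ℕ} {σ : Equiv.Perm (Fin n)} (hσ : IsCyclicPerm σ)
    (x y : Fin n) : ∃ i < n, (σ ^ i) x = y := by
  have hne : ∀ z, σ z ≠ z := fun z => Equiv.Perm.mem_support.1 (hσ.2 ▸ mem_univ z)
  obtain ⟨i, hi, hxy⟩ := (hσ.1.sameCycle (hne x) (hne y)).exists_pow_eq'
  exact ⟨i, hi.trans_le (hσ.1.orderOf ▸ card_finset_fin_le _), hxy⟩

/-- Two consecutive intervals of total length `p + q ≥ n` cover `[n]`, hence meet in at most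
`p + q - n` elements. -/
theorem IsCyclicPerm.card_inter_add_le {n : ℕ} {σ : Equiv.Perm (Fin n)} (hσ : IsCyclicPerm σ)
    {p q : ℕ} (hpq : n ≤ p + q) (x : Fin n) :
    ((range p).image (fun i => (σ ^ i) x) ∩
      (range q).image (fun i => (σ ^ i) ((σ ^ p) x))).card + n ≤ p + q := by
  set A := (range p).image (fun i => (σ ^ i) x)
  set B := (range q).image (fun i => (σ ^ i) ((σ ^ p) x))
  have hunion : A ∪ B = univ := by
    refine eq_univ_iff_forall.2 fun y => ?_
    obtain ⟨i, hi, rfl⟩ := hσ.exists_pow_apply_eq x y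
    rcases lt_or_ge i p with h | h
    · exact mem_union_left _ (mem_image_of_mem _ (mem_range.2 h))
    · refine mem_union_right _ (mem_image.2 ⟨i - p, mem_range.2 (by omega), ?_⟩)
      rw [← Equiv.Perm.mul_apply, ← pow_add, Nat.sub_add_cancel h]
  have hcard := card_union_add_card_inter A B
  rw [hunion, card_univ, Fintype.card_fin] at hcard
  have hA : A.card ≤ p := card_image_le.trans_eq (card_range p)
  have hB : B.card ≤ q := card_image_le.trans_eq (card_range q)
  omega

theorem card_filter_card_eq_le_card_starts {n : ℕ} {σ : Equiv.Perm (Fin n)}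
    {G : Finset (Finset (Fin n))} (hG : ∀ A ∈ G, IsIntervalOf σ A) (p : ℕ) :
    (G.filter (fun A => A.card = p)).card ≤
      (univ.filter (fun x : Fin n => (range p).image (fun i => (σ ^ i) x) ∈ G)).card := by
  refine (card_le_card ?_).trans
    (card_image_le (f := fun x : Fin n => (range p).image (fun i => (σ ^ i) x)))
  intro A hA
  obtain ⟨hAG, rfl⟩ := mem_filter.1 hA
  obtain ⟨-, -, x, hx⟩ := hG A hAG
  exact mem_image.2 ⟨x, mem_filter.2 ⟨mem_univ x, hx ▸ hAG⟩, hx.symm⟩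

/-- In a `t`-intersecting family of intervals, the numbers of members of two lengths with sum
`n + t - 1` add up to at most `n`. -/
theorem card_filter_add_card_filter_le {n t : ℕ} (ht : 0 < t) {σ : Equiv.Perm (Fin n)}
    (hσ : IsCyclicPerm σ) {G : Finset (Finset (Fin n))} (hG : ∀ A ∈ G, IsIntervalOf σ A)
    (hinter : TIntersecting t G) {p q : ℕ} (hpq : p + q + 1 = n + t) :
    (G.filter (fun A => A.card = p)).card + (G.filter (fun A => A.card = q)).card ≤ n := by
  refine (add_le_add (card_filter_card_eq_le_card_starts hG p)
    (card_filter_card_eq_le_card_starts hG q)).trans ?_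
  set S := univ.filter (fun x : Fin n => (range p).image (fun i => (σ ^ i) x) ∈ G)
  set T := univ.filter (fun x : Fin n => (range q).image (fun i => (σ ^ i) x) ∈ G)
  have hdisj : Disjoint (S.map (σ ^ p).toEmbedding) T := by
    refine disjoint_left.2 fun y hy hyT => ?_
    obtain ⟨x, hx, rfl⟩ := mem_map.1 hy
    have hle := hσ.card_inter_add_le (p := p) (q := q) (by omega) x
    have hge := hinter _ (mem_filter.1 hx).2 _ (mem_filter.1 hyT).2
    rw [Equiv.coe_toEmbedding] at hge
    omega
  rw [← card_map (σ ^ p).toEmbedding, ← card_union_of_disjoint hdisj]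
  exact card_finset_fin_le _

/-- (Lemma on interval counts, inequality (1).) With `g_i` the number of
intervals of length `(n+t)/2 + i` in a full consecutive `σ`-`k`-Sperner `t`-intersecting
family as described, `g_{-j-1} + g_j ≤ n` for all `0 ≤ j ≤ m - 1` with `j < k - m`. -/
theorem stmt_13 (t k : ℕ) (ht : 0 < t) (hk : 0 < k) :
    ∃ n₀ : ℕ, ∀ n : ℕ, n₀ ≤ n → Even (n + t) →
      ∀ σ : Equiv.Perm (Fin n), IsCyclicPerm σ →
      ∀ m : ℕ, m < k →
      ∀ G : Finset (Finset (Fin n)),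
        SigmaKSpernerTIntersecting σ k t G → FullConsecutive σ k G →
        (∀ A ∈ G, ((n + t) / 2 : ℤ) - m ≤ A.card) →
        (∃ A ∈ G, (A.card : ℤ) = ((n + t) / 2 : ℤ) - m) →
        (∀ A ∈ G, (A.card : ℤ) ≤ ((n + t) / 2 : ℤ) + k - 1 + m) →
        ∀ (g : ℤ → ℕ)
    (hg : ∀ i : ℤ, g i = (G.filter (fun S => (S.card : ℤ) = ((n + t) / 2 : ℤ) + i)).card),
        ∀ j : ℕ, j + 1 ≤ m → j + m < k →
          g (-(j : ℤ) - 1) + g (j : ℤ) ≤ n := by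
  refine ⟨0, fun n _ heven σ hσ m _ G hG _ _ hmin _ g hg j hj _ => ?_⟩
  obtain ⟨A, -, hA⟩ := hmin
  obtain ⟨N, hN⟩ := heven
  have hhalf : ((n + t) / 2 : ℤ) = N := by omega
  rw [hhalf] at hA
  have key := card_filter_add_card_filter_le ht hσ hG.1 hG.2.1
    (p := N - j - 1) (q := N + j) (by omega)
  rw [hg, hg, hhalf]
  convert key using 4 <;> omega
end

section
/- Let t and k be positive integers. There exists n0 = n0(t,k) such that for all n ≥ n0 with n+t even the following holds: let σ be a cyclic permutation of [n], let m be an integer with 0 ≤ m < k, and let G be a full consecutive σ-k-Sperner t-intersecting family of intervals of σ with min{|G| : G ∈ G} = (n+t)/2 − m and max{|G| : G ∈ G} ≤ (n+t)/2 + k − 1 + m; let g_i be the number of intervals of G of length (n+t)/2 + i. Then Σ_{i=−m}^{k−j} g_i ≤ (k−j+1)·n − Σ_{i=j}^{m} g_{−i} for every integer j with 1 ≤ j ≤ m and j < k−m. -/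
open Finset

/-- The set of the first `ℓ` points of the `σ`-orbit of `x`. -/
def orbitSegment {n : ℕ} (σ : Equiv.Perm (Fin n)) (x : Fin n) (ℓ : ℕ) : Finset (Fin n) :=
  (Finset.range ℓ).image (fun i => (σ ^ i) x)

theorem IsCyclicPerm.pow_apply_eq_pow_apply {n : ℕ} {σ : Equiv.Perm (Fin n)}
    (hσ : IsCyclicPerm σ) (x : Fin n) {i j : ℕ} :
    (σ ^ i) x = (σ ^ j) x ↔ i ≡ j [MOD n] := by
  have h : σ.IsCycleOn (Finset.univ : Finset (Fin n)) := by
    have h₀ := hσ.1.isCycleOn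
    have h₁ : {y | σ y ≠ y} = ((Finset.univ : Finset (Fin n)) : Set (Fin n)) := by
      rw [← hσ.2]; ext y; simp
    rwa [h₁] at h₀
  simpa using h.pow_apply_eq_pow_apply (Finset.mem_univ x) (m := i) (n := j)

theorem IsCyclicPerm.card_orbitSegment {n : ℕ} {σ : Equiv.Perm (Fin n)}
    (hσ : IsCyclicPerm σ) (x : Fin n) {ℓ : ℕ} (hℓ : ℓ ≤ n) :
    (orbitSegment σ x ℓ).card = ℓ := by
  rw [orbitSegment, Finset.card_image_of_injOn, Finset.card_range]
  intro i hi j hj hij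
  simp only [Finset.coe_range, Set.mem_Iio] at hi hj
  exact ((hσ.pow_apply_eq_pow_apply x).1 hij).eq_of_lt_of_lt (by omega) (by omega)

theorem orbitSegment_mono {n : ℕ} (σ : Equiv.Perm (Fin n)) (x : Fin n) {ℓ ℓ' : ℕ}
    (h : ℓ ≤ ℓ') : orbitSegment σ x ℓ ⊆ orbitSegment σ x ℓ' :=
  Finset.image_subset_image (Finset.range_mono h)

theorem orbitSegment_add_subset {n : ℕ} (σ : Equiv.Perm (Fin n)) (x : Fin n) (ℓ ℓ' : ℕ) :
    orbitSegment σ x (ℓ + ℓ') ⊆ orbitSegment σ x ℓ ∪ orbitSegment σ ((σ ^ ℓ) x) ℓ' := by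
  intro y hy
  simp only [orbitSegment, Finset.mem_image, Finset.mem_range, Finset.mem_union] at hy ⊢
  obtain ⟨i, hi, rfl⟩ := hy
  by_cases h : i < ℓ
  · exact Or.inl ⟨i, h, rfl⟩
  · refine Or.inr ⟨i - ℓ, by omega, ?_⟩
    rw [← Equiv.Perm.mul_apply, ← pow_add, Nat.sub_add_cancel (by omega)]

/-- Two consecutive segments meeting in at least `t > 0` points have total length `≥ n + t`. -/
theorem IsCyclicPerm.add_le_of_le_card_inter {n t : ℕ} {σ : Equiv.Perm (Fin n)}
    (hσ : IsCyclicPerm σ) (ht : 0 < t) (x : Fin n) {ℓ ℓ' : ℕ} (hℓ : ℓ ≤ n) (hℓ' : ℓ' ≤ n)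
    (h : t ≤ (orbitSegment σ x ℓ ∩ orbitSegment σ ((σ ^ ℓ) x) ℓ').card) :
    n + t ≤ ℓ + ℓ' := by
  have h₁ := Finset.card_union_add_card_inter
    (orbitSegment σ x ℓ) (orbitSegment σ ((σ ^ ℓ) x) ℓ')
  rw [hσ.card_orbitSegment x hℓ, hσ.card_orbitSegment _ hℓ'] at h₁
  have h₂ := Finset.card_le_card ((orbitSegment_mono σ x (min_le_left (ℓ + ℓ') n)).trans
    (orbitSegment_add_subset σ x ℓ ℓ'))
  rw [hσ.card_orbitSegment x (min_le_right _ _)] at h₂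
  omega

theorem IsCyclicPerm.orbitSegment_mem {n : ℕ} {σ : Equiv.Perm (Fin n)}
    (hσ : IsCyclicPerm σ) {G : Finset (Finset (Fin n))} {h : Fin n} {ℓ : ℕ}
    (hℓ : ℓ ∈ (G ∩ chainAt σ h).image Finset.card) :
    orbitSegment σ (σ h) ℓ ∈ G ∧ ℓ ≤ n := by
  simp only [chainAt, Finset.mem_image, Finset.mem_inter, Finset.mem_Icc] at hℓ
  obtain ⟨A, ⟨hA, ℓ', hℓ', rfl⟩, rfl⟩ := hℓ
  have hc := hσ.card_orbitSegment (σ h) (show ℓ' ≤ n by omega)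
  simp only [orbitSegment] at hc ⊢
  rw [hc]
  exact ⟨hA, by omega⟩

/-- A member of length `ℓ` of a family of intervals is the segment of length `ℓ` of some chain. -/
theorem card_filter_card_eq_le {n : ℕ} {σ : Equiv.Perm (Fin n)} {G : Finset (Finset (Fin n))}
    (hG : ∀ A ∈ G, IsIntervalOf σ A) (ℓ : ℕ) :
    (G.filter (fun S => S.card = ℓ)).card ≤
      (Finset.univ.filter (fun h => ℓ ∈ (G ∩ chainAt σ h).image Finset.card)).card := by
  refine (Finset.card_le_card ?_).trans
    (Finset.card_image_le (f := fun h => orbitSegment σ (σ h) ℓ))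
  intro A hA
  obtain ⟨hAG, rfl⟩ := Finset.mem_filter.1 hA
  obtain ⟨h₁, h₂, x, hx⟩ := hG A hAG
  refine Finset.mem_image.2 ⟨σ⁻¹ x, Finset.mem_filter.2 ⟨Finset.mem_univ _,
    Finset.mem_image.2 ⟨A, Finset.mem_inter.2 ⟨hAG, ?_⟩, rfl⟩⟩, ?_⟩
  · exact Finset.mem_image.2 ⟨A.card, Finset.mem_Icc.2 ⟨h₁, h₂⟩, by simpa using hx.symm⟩
  · simpa [orbitSegment] using hx.symm

theorem sum_nonneg_of_card_le_neg_le {ι : Type*} (s : Finset ι) (α : ι → ℤ) (m : ℕ)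
    (hα : ∀ h ∈ s, -(m : ℤ) ≤ α h ∧ α h ≤ m)
    (hcard : ∀ q ∈ Finset.Icc (1 : ℤ) m,
      (s.filter (fun h => α h ≤ -q)).card ≤ (s.filter (fun h => q ≤ α h)).card) :
    0 ≤ ∑ h ∈ s, α h := by
  have key : ∀ h ∈ s, α h = ∑ q ∈ Finset.Icc (1 : ℤ) m,
      ((if q ≤ α h then 1 else 0) - (if α h ≤ -q then 1 else 0)) := by
    intro h hs
    obtain ⟨h₁, h₂⟩ := hα h hs
    rw [Finset.sum_sub_distrib, Finset.sum_boole, Finset.sum_boole]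
    have e₁ : (Finset.Icc (1 : ℤ) m).filter (fun q => q ≤ α h) = Finset.Icc 1 (α h) := by
      ext q; simp only [Finset.mem_filter, Finset.mem_Icc]; omega
    have e₂ : (Finset.Icc (1 : ℤ) m).filter (fun q => α h ≤ -q) = Finset.Icc 1 (-α h) := by
      ext q; simp only [Finset.mem_filter, Finset.mem_Icc]; omega
    rw [e₁, e₂, Int.card_Icc, Int.card_Icc]
    omega
  rw [Finset.sum_congr rfl key, Finset.sum_comm]
  refine Finset.sum_nonneg fun q hq => ?_
  rw [Finset.sum_sub_distrib, Finset.sum_boole, Finset.sum_boole]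
  have := hcard q hq
  omega

theorem card_window_add_card_window {k m j : ℕ} {α : ℤ} (hj : 1 ≤ j) (hjm : j + m < k)
    (h₁ : -(m : ℤ) ≤ α) (h₂ : α ≤ m) :
    (((Finset.Icc (-(m : ℤ)) ((k : ℤ) - j)).filter (fun i => α ≤ i ∧ i < α + k)).card : ℤ) +
      (((Finset.Icc (j : ℤ) m).filter (fun i => α ≤ -i ∧ -i < α + k)).card : ℤ) =
      k - j + 1 - α := by
  have e₁ : (Finset.Icc (-(m : ℤ)) ((k : ℤ) - j)).filter (fun i => α ≤ i ∧ i < α + k) =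
      Finset.Icc α (min ((k : ℤ) - j) (α + k - 1)) := by
    ext i; simp only [Finset.mem_filter, Finset.mem_Icc]; omega
  have e₂ : (Finset.Icc (j : ℤ) m).filter (fun i => α ≤ -i ∧ -i < α + k) =
      Finset.Icc (j : ℤ) (-α) := by
    ext i; simp only [Finset.mem_filter, Finset.mem_Icc]; omega
  rw [e₁, e₂, Int.card_Icc, Int.card_Icc]
  omega

/-- (Lemma on interval counts, inequality (3).)
`∑_{i=-m}^{k-j} g_i ≤ (k-j+1)n - ∑_{i=j}^{m} g_{-i}` for all `1 ≤ j ≤ m` with `j < k - m`. -/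
theorem stmt_15 (t k : ℕ) (ht : 0 < t) (hk : 0 < k) :
    ∃ n₀ : ℕ, ∀ n : ℕ, n₀ ≤ n → Even (n + t) →
      ∀ σ : Equiv.Perm (Fin n), IsCyclicPerm σ →
      ∀ m : ℕ, m < k →
      ∀ G : Finset (Finset (Fin n)),
        SigmaKSpernerTIntersecting σ k t G → FullConsecutive σ k G →
        (∀ A ∈ G, ((n + t) / 2 : ℤ) - m ≤ A.card) →
        (∃ A ∈ G, (A.card : ℤ) = ((n + t) / 2 : ℤ) - m) →
        (∀ A ∈ G, (A.card : ℤ) ≤ ((n + t) / 2 : ℤ) + k - 1 + m) →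
        ∀ (g : ℤ → ℕ)
    (hg : ∀ i : ℤ, g i = (G.filter (fun S => (S.card : ℤ) = ((n + t) / 2 : ℤ) + i)).card),
        ∀ j : ℕ, 1 ≤ j → j ≤ m → j + m < k →
          ∑ i ∈ Finset.Icc (-(m : ℤ)) ((k : ℤ) - j), (g i : ℤ) ≤
            ((k : ℤ) - j + 1) * n - ∑ i ∈ Finset.Icc (j : ℤ) (m : ℤ), (g (-i) : ℤ) := by
  refine ⟨0, fun n _ hnt σ hσ m hmk G hG hF hmin _ hmax g hg j hj hjm hjk => ?_⟩
  obtain ⟨hint, hinter, -⟩ := hG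
  obtain ⟨c, hc⟩ := hnt
  have hc' : ((n : ℤ) + t) / 2 = c := by omega
  simp only [hc'] at hmin hmax hg
  choose a ha using hF.1
  simp only [hF.2] at ha
  have hmem : ∀ h, ∀ ℓ, a h ≤ ℓ → ℓ < a h + k → orbitSegment σ (σ h) ℓ ∈ G ∧ ℓ ≤ n := by
    intro h ℓ h₁ h₂
    apply hσ.orbitSegment_mem
    rw [ha]
    exact Finset.mem_Ico.2 ⟨h₁, h₂⟩
  have hlo : ∀ h, -(m : ℤ) ≤ (a h : ℤ) - c := by
    intro h
    obtain ⟨h₁, h₂⟩ := hmem h (a h) le_rfl (by omega)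
    have h₃ := hmin _ h₁
    rw [hσ.card_orbitSegment _ h₂] at h₃
    omega
  have hhi : ∀ h, (a h : ℤ) - c ≤ m := by
    intro h
    obtain ⟨h₁, h₂⟩ := hmem h (a h + k - 1) (by omega) (by omega)
    have h₃ := hmax _ h₁
    rw [hσ.card_orbitSegment _ h₂] at h₃
    omega
  have hnonneg : 0 ≤ ∑ h, ((a h : ℤ) - c) := by
    refine sum_nonneg_of_card_le_neg_le _ _ m (fun h _ => ⟨hlo h, hhi h⟩) fun q hq => ?_
    rw [Finset.mem_Icc] at hq
    refine Finset.card_le_card_of_injOn (fun h => (σ ^ (c - q).toNat) h) ?_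
      (Equiv.injective _).injOn
    intro h hh
    simp only [Finset.coe_filter, Finset.mem_univ, true_and, Set.mem_ofPred_eq] at hh ⊢
    set y := (σ ^ (c - q).toNat) h with hy
    have hlo' := hlo h
    obtain ⟨h₁, h₂⟩ := hmem h (c - q).toNat (by omega) (by omega)
    obtain ⟨h₃, h₄⟩ := hmem y (a y) le_rfl (by omega)
    have hshift : σ y = (σ ^ (c - q).toNat) (σ h) := by
      rw [hy, ← Equiv.Perm.mul_apply, ← Equiv.Perm.mul_apply, ← pow_succ, ← pow_succ']
    have h₅ := hinter _ h₁ _ h₃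
    rw [hshift] at h₅
    have h₆ := hσ.add_le_of_le_card_inter ht _ h₂ h₄ h₅
    omega
  have hgle : ∀ i : ℤ, (g i : ℤ) ≤
      ∑ h, if (a h : ℤ) - c ≤ i ∧ i < (a h : ℤ) - c + k then 1 else 0 := by
    intro i
    rw [Finset.sum_boole, hg]
    by_cases hi : 0 ≤ (c : ℤ) + i
    · have h₁ := card_filter_card_eq_le hint ((c : ℤ) + i).toNat
      simp only [ha, Finset.mem_Ico] at h₁
      have e₁ : G.filter (fun S => (S.card : ℤ) = c + i) =
          G.filter (fun S => S.card = ((c : ℤ) + i).toNat) :=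
        Finset.filter_congr fun S _ => by omega
      have e₂ : (Finset.univ.filter fun h =>
            (a h : ℤ) - c ≤ i ∧ i < (a h : ℤ) - c + k) =
          Finset.univ.filter fun h =>
            a h ≤ ((c : ℤ) + i).toNat ∧ ((c : ℤ) + i).toNat < a h + k :=
        Finset.filter_congr fun h _ => by omega
      rw [e₁, e₂]
      exact_mod_cast h₁
    · rw [Finset.filter_false_of_mem fun S _ => by omega]
      simp
  have hsum : ∑ i ∈ Finset.Icc (-(m : ℤ)) ((k : ℤ) - j), (g i : ℤ) +
      ∑ i ∈ Finset.Icc (j : ℤ) (m : ℤ), (g (-i) : ℤ) ≤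
      ∑ h, ((k : ℤ) - j + 1 - ((a h : ℤ) - c)) := by
    refine (add_le_add (Finset.sum_le_sum fun i _ => hgle i)
      (Finset.sum_le_sum fun i _ => hgle (-i))).trans_eq ?_
    rw [Finset.sum_comm, Finset.sum_comm (s := Finset.Icc (j : ℤ) m),
      ← Finset.sum_add_distrib]
    refine Finset.sum_congr rfl fun h _ => ?_
    rw [Finset.sum_boole, Finset.sum_boole]
    exact card_window_add_card_window hj hjk (hlo h) (hhi h)
  rw [Finset.sum_sub_distrib, Finset.sum_const, Finset.card_univ, Fintype.card_fin,
    nsmul_eq_mul] at hsum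
  linarith
end
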